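/- arXiv:math/0611358 — 2 statements merged into one kernel-verified Lean document; each statement's English description precedes it below -/
import Mathlib

section
/- Assume the left Gorenstein global dimension of R is at most n for some non-negative integer n. If an R-module M has finite flat dimension, then M has finite projective dimension, and pd_R(M) ≤ n, id_R(M) ≤ n, and fd_R(M) ≤ n. -/
/-! Definitions for Gorenstein homological algebra over an arbitrary
associative ring `R` (left modules; right modules are `Rᵐᵒᵖ`-modules). -/

universe u

section Defs

variable (R : Type u) [Ring R]

/-- `0 → A → B → C → 0` is a short exact sequence. -/
def IsSES {A B C : Type u} [AddCommGroup A] [Module R A] [AddCommGroup B] [Module R B]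
    [AddCommGroup C] [Module R C] (f : A →ₗ[R] B) (g : B →ₗ[R] C) : Prop :=
  Function.Injective f ∧ Function.Exact f g ∧ Function.Surjective g

/-- `M` is Gorenstein projective: it is the kernel of a map in a doubly infinite exact
complex of projective modules which stays exact under `Hom_R(-, Q)` for every projective `Q`. -/
def GorensteinProjective (M : Type u) [AddCommGroup M] [Module R M] : Prop :=
  ∃ (P : ℤ → Type u) (_ : ∀ i, AddCommGroup (P i)) (_ : ∀ i, Module R (P i))
    (d : ∀ i, P i →ₗ[R] P (i + 1)),
      (∀ i, Module.Projective R (P i)) ∧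
      (∀ i, Function.Exact (d i) (d (i + 1))) ∧
      Nonempty (M ≃ₗ[R] LinearMap.ker (d 0)) ∧
      (∀ (Q : Type u) (_ : AddCommGroup Q) (_ : Module R Q), Module.Projective R Q →
        ∀ i, Function.Exact (fun g : P (i + 1 + 1) →ₗ[R] Q => g.comp (d (i + 1)))
          (fun g : P (i + 1) →ₗ[R] Q => g.comp (d i)))

/-- `M` is strongly Gorenstein projective: there is a complete projective resolution
with a single projective module `P` and a single map `f`. -/
def StronglyGorensteinProjective (M : Type u) [AddCommGroup M] [Module R M] : Prop :=
  ∃ (P : Type u) (_ : AddCommGroup P) (_ : Module R P) (f : P →ₗ[R] P),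
    Module.Projective R P ∧
    Function.Exact f f ∧
    Nonempty (M ≃ₗ[R] LinearMap.ker f) ∧
    (∀ (Q : Type u) (_ : AddCommGroup Q) (_ : Module R Q), Module.Projective R Q →
      Function.Exact (fun g : P →ₗ[R] Q => g.comp f) (fun g : P →ₗ[R] Q => g.comp f))

/-- `M` is Gorenstein injective (dual to Gorenstein projective). -/
def GorensteinInjective (M : Type u) [AddCommGroup M] [Module R M] : Prop :=
  ∃ (I : ℤ → Type u) (_ : ∀ i, AddCommGroup (I i)) (_ : ∀ i, Module R (I i))
    (d : ∀ i, I i →ₗ[R] I (i + 1)),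
      (∀ i, Module.Injective R (I i)) ∧
      (∀ i, Function.Exact (d i) (d (i + 1))) ∧
      Nonempty (M ≃ₗ[R] LinearMap.ker (d 0)) ∧
      (∀ (E : Type u) (_ : AddCommGroup E) (_ : Module R E), Module.Injective R E →
        ∀ i, Function.Exact (fun g : E →ₗ[R] I i => (d i).comp g)
          (fun g : E →ₗ[R] I (i + 1) => (d (i + 1)).comp g))

/-- `M` is strongly Gorenstein injective. -/
def StronglyGorensteinInjective (M : Type u) [AddCommGroup M] [Module R M] : Prop :=
  ∃ (I : Type u) (_ : AddCommGroup I) (_ : Module R I) (f : I →ₗ[R] I),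
    Module.Injective R I ∧
    Function.Exact f f ∧
    Nonempty (M ≃ₗ[R] LinearMap.ker f) ∧
    (∀ (E : Type u) (_ : AddCommGroup E) (_ : Module R E), Module.Injective R E →
      Function.Exact (fun g : E →ₗ[R] I => f.comp g) (fun g : E →ₗ[R] I => f.comp g))

/-- `M` admits a resolution `0 → G_n → ⋯ → G_0 → M → 0` by modules satisfying `𝒢`
(formalized as an `ℕ`-indexed resolution vanishing in degrees `> n`). -/
def HasLeftResolutionLE
    (𝒢 : ∀ (N : Type u) [AddCommGroup N] [Module R N], Prop)
    (M : Type u) [AddCommGroup M] [Module R M] (n : ℕ) : Prop :=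
  ∃ (G : ℕ → Type u) (_ : ∀ i, AddCommGroup (G i)) (_ : ∀ i, Module R (G i))
    (d : ∀ i, G (i + 1) →ₗ[R] G i) (π : G 0 →ₗ[R] M),
      (∀ i, 𝒢 (G i)) ∧
      (∀ i, n < i → Subsingleton (G i)) ∧
      Function.Surjective π ∧ Function.Exact (d 0) π ∧
      (∀ i, Function.Exact (d (i + 1)) (d i))

/-- `M` admits a coresolution `0 → M → G^0 → ⋯ → G^n → 0` by modules satisfying `𝒢`. -/
def HasRightResolutionLE
    (𝒢 : ∀ (N : Type u) [AddCommGroup N] [Module R N], Prop)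
    (M : Type u) [AddCommGroup M] [Module R M] (n : ℕ) : Prop :=
  ∃ (G : ℕ → Type u) (_ : ∀ i, AddCommGroup (G i)) (_ : ∀ i, Module R (G i))
    (d : ∀ i, G i →ₗ[R] G (i + 1)) (ι : M →ₗ[R] G 0),
      (∀ i, 𝒢 (G i)) ∧
      (∀ i, n < i → Subsingleton (G i)) ∧
      Function.Injective ι ∧ Function.Exact ι (d 0) ∧
      (∀ i, Function.Exact (d i) (d (i + 1)))

variable (M : Type u) [AddCommGroup M] [Module R M]

/-- Projective dimension, valued in `ℕ∞`. -/
noncomputable def pDim : ℕ∞ :=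
  sInf ((↑) '' {n : ℕ | HasLeftResolutionLE R (fun N _ _ => Module.Projective R N) M n})

/-- Injective dimension, valued in `ℕ∞`. -/
noncomputable def iDim : ℕ∞ :=
  sInf ((↑) '' {n : ℕ | HasRightResolutionLE R (fun N _ _ => Module.Injective R N) M n})

/-- Gorenstein projective dimension, valued in `ℕ∞`. -/
noncomputable def gpDim : ℕ∞ :=
  sInf ((↑) '' {n : ℕ | HasLeftResolutionLE R (fun N _ _ => GorensteinProjective R N) M n})

/-- Gorenstein injective dimension, valued in `ℕ∞`. -/
noncomputable def giDim : ℕ∞ :=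
  sInf ((↑) '' {n : ℕ | HasRightResolutionLE R (fun N _ _ => GorensteinInjective R N) M n})

/-- The left global dimension of `R`. -/
noncomputable def gldim : ℕ∞ :=
  sSup {d : ℕ∞ | ∃ (M : Type u) (_ : AddCommGroup M) (_ : Module R M), d = pDim R M}

/-- The left finitistic projective dimension of `R`. -/
noncomputable def FPD : ℕ∞ :=
  sSup {d : ℕ∞ | ∃ (M : Type u) (_ : AddCommGroup M) (_ : Module R M),
    pDim R M ≠ ⊤ ∧ d = pDim R M}

/-- The left Gorenstein global dimension of `R`: `sup { Gpd_R(M) }`. -/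
noncomputable def GPgldim : ℕ∞ :=
  sSup {d : ℕ∞ | ∃ (M : Type u) (_ : AddCommGroup M) (_ : Module R M), d = gpDim R M}

/-- `sup { Gid_R(M) }` over all left `R`-modules `M`. -/
noncomputable def GIgldim : ℕ∞ :=
  sSup {d : ℕ∞ | ∃ (M : Type u) (_ : AddCommGroup M) (_ : Module R M), d = giDim R M}

end Defs
section Tensor

open TensorProduct

variable (R : Type u) [Ring R]

/-- The defining relations of the tensor product `N ⊗_R M` of a right `R`-module `N`
and a left `R`-module `M`, inside the tensor product of abelian groups `N ⊗[ℤ] M`. -/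
noncomputable def tensorRel (N : Type u) [AddCommGroup N] [Module Rᵐᵒᵖ N]
    (M : Type u) [AddCommGroup M] [Module R M] : AddSubgroup (N ⊗[ℤ] M) :=
  AddSubgroup.closure {x | ∃ (r : R) (n : N) (m : M),
    x = (MulOpposite.op r • n) ⊗ₜ[ℤ] m - n ⊗ₜ[ℤ] (r • m)}

/-- The tensor product `N ⊗_R M` (an abelian group) of a right `R`-module `N` and a
left `R`-module `M` over the (possibly noncommutative) ring `R`. -/
abbrev bTensor (N : Type u) [AddCommGroup N] [Module Rᵐᵒᵖ N]
    (M : Type u) [AddCommGroup M] [Module R M] : Type u :=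
  (N ⊗[ℤ] M) ⧸ tensorRel R N M

/-- The map `N ⊗_R M →+ N ⊗_R M'` induced by a map `f : M →ₗ[R] M'` of left modules. -/
noncomputable def tmapRight (N : Type u) [AddCommGroup N] [Module Rᵐᵒᵖ N]
    {M M' : Type u} [AddCommGroup M] [Module R M] [AddCommGroup M'] [Module R M']
    (f : M →ₗ[R] M') : bTensor R N M →+ bTensor R N M' :=
  QuotientAddGroup.map _ _ (LinearMap.lTensor N (f.restrictScalars ℤ)).toAddMonoidHom <| by
    rw [tensorRel, AddSubgroup.closure_le]
    rintro x ⟨r, n, m, rfl⟩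
    simp only [AddSubgroup.coe_comap, Set.mem_preimage, LinearMap.toAddMonoidHom_coe,
      map_sub, LinearMap.lTensor_tmul, SetLike.mem_coe]
    refine AddSubgroup.subset_closure ⟨r, n, f m, ?_⟩
    simp [LinearMap.map_smul]

/-- The map `N ⊗_R M →+ N' ⊗_R M` induced by a map `g : N →ₗ[Rᵐᵒᵖ] N'` of right modules. -/
noncomputable def tmapLeft {N N' : Type u} [AddCommGroup N] [Module Rᵐᵒᵖ N]
    [AddCommGroup N'] [Module Rᵐᵒᵖ N']
    (M : Type u) [AddCommGroup M] [Module R M]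
    (g : N →ₗ[Rᵐᵒᵖ] N') : bTensor R N M →+ bTensor R N' M :=
  QuotientAddGroup.map _ _ (LinearMap.rTensor M (g.restrictScalars ℤ)).toAddMonoidHom <| by
    rw [tensorRel, AddSubgroup.closure_le]
    rintro x ⟨r, n, m, rfl⟩
    simp only [AddSubgroup.coe_comap, Set.mem_preimage, LinearMap.toAddMonoidHom_coe,
      map_sub, LinearMap.rTensor_tmul, SetLike.mem_coe]
    refine AddSubgroup.subset_closure ⟨r, g n, m, ?_⟩
    simp [LinearMap.map_smul]

/-- A left `R`-module `M` is flat if `- ⊗_R M` preserves injectivity of maps of right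
`R`-modules. -/
def ModFlat (M : Type u) [AddCommGroup M] [Module R M] : Prop :=
  ∀ (N N' : Type u) (_ : AddCommGroup N) (_ : Module Rᵐᵒᵖ N)
    (_ : AddCommGroup N') (_ : Module Rᵐᵒᵖ N') (g : N →ₗ[Rᵐᵒᵖ] N'),
      Function.Injective g → Function.Injective (tmapLeft R M g)

/-- `M` is Gorenstein flat: it is the kernel of a map in a doubly infinite exact complex
of flat modules which stays exact under `E ⊗_R -` for every injective right `R`-module `E`. -/
def GorensteinFlat (M : Type u) [AddCommGroup M] [Module R M] : Prop :=
  ∃ (F : ℤ → Type u) (_ : ∀ i, AddCommGroup (F i)) (_ : ∀ i, Module R (F i))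
    (d : ∀ i, F i →ₗ[R] F (i + 1)),
      (∀ i, ModFlat R (F i)) ∧
      (∀ i, Function.Exact (d i) (d (i + 1))) ∧
      Nonempty (M ≃ₗ[R] LinearMap.ker (d 0)) ∧
      (∀ (E : Type u) (_ : AddCommGroup E) (_ : Module Rᵐᵒᵖ E), Module.Injective Rᵐᵒᵖ E →
        ∀ i, Function.Exact (tmapRight R E (d i)) (tmapRight R E (d (i + 1))))

/-- Flat dimension, valued in `ℕ∞`. -/
noncomputable def fDim (M : Type u) [AddCommGroup M] [Module R M] : ℕ∞ :=
  sInf ((↑) '' {n : ℕ | HasLeftResolutionLE R (fun N _ _ => ModFlat R N) M n})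

/-- Gorenstein flat dimension, valued in `ℕ∞`. -/
noncomputable def gfDim (M : Type u) [AddCommGroup M] [Module R M] : ℕ∞ :=
  sInf ((↑) '' {n : ℕ | HasLeftResolutionLE R (fun N _ _ => GorensteinFlat R N) M n})

/-- The weak global dimension of `R`. -/
noncomputable def wgldim : ℕ∞ :=
  sSup {d : ℕ∞ | ∃ (M : Type u) (_ : AddCommGroup M) (_ : Module R M), d = fDim R M}

/-- The left weak Gorenstein global dimension of `R`: `sup { Gfd_R(M) }`. -/
noncomputable def GFgldim : ℕ∞ :=
  sSup {d : ℕ∞ | ∃ (M : Type u) (_ : AddCommGroup M) (_ : Module R M), d = gfDim R M}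

end Tensor

section ExtWrap
open CategoryTheory CategoryTheory.Abelian

variable (R : Type u) [Ring R]

/-- Vanishing of `Ext^i_R(A, Y)`. -/
def ExtZ (A Y : Type u) [AddCommGroup A] [Module R A] [AddCommGroup Y] [Module R Y] (i : ℕ) : Prop :=
  Subsingleton (Ext.{u} (ModuleCat.of R A) (ModuleCat.of R Y) i)

/-- `pd A < n`. -/
def PdLT (A : Type u) [AddCommGroup A] [Module R A] (n : ℕ) : Prop :=
  ∀ (Y : Type u) [AddCommGroup Y] [Module R Y] (i : ℕ), n ≤ i → ExtZ R A Y i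

variable {R}
variable {A B C X Y : Type u} [AddCommGroup A] [Module R A] [AddCommGroup B] [Module R B]
  [AddCommGroup C] [Module R C] [AddCommGroup X] [Module R X] [AddCommGroup Y] [Module R Y]

theorem IsSES.shortExact {f : A →ₗ[R] B} {g : B →ₗ[R] C} (h : IsSES R f g) :
    (ShortComplex.mk (ModuleCat.ofHom f) (ModuleCat.ofHom g)
      (by ext x; exact h.2.1.apply_apply_eq_zero x)).ShortExact := by
  have := (ModuleCat.mono_iff_injective (ModuleCat.ofHom f)).2 h.1
  have := (ModuleCat.epi_iff_surjective (ModuleCat.ofHom g)).2 h.2.2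
  refine ShortComplex.ShortExact.mk ?_
  rw [ShortComplex.moduleCat_exact_iff]
  intro x hx
  exact (h.2.1 x).1 hx

theorem ExtZ.third {f : A →ₗ[R] B} {g : B →ₗ[R] C} (h : IsSES R f g) {i : ℕ}
    (hA : ExtZ R A Y i) (hB : ExtZ R B Y (i + 1)) : ExtZ R C Y (i + 1) := by
  refine ⟨fun x y => ?_⟩
  suffices ∀ x : Ext.{u} (ModuleCat.of R C) (ModuleCat.of R Y) (i + 1), x = 0 by
    rw [this x, this y]
  intro x
  obtain ⟨z, rfl⟩ := Ext.contravariant_sequence_exact₃ h.shortExact (ModuleCat.of R Y) x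
    (hB.elim _ _) (add_comm 1 i)
  rw [hA.elim z 0, Ext.comp_zero]

theorem ExtZ.first {f : A →ₗ[R] B} {g : B →ₗ[R] C} (h : IsSES R f g) {i : ℕ}
    (hB : ExtZ R B Y i) (hC : ExtZ R C Y (i + 1)) : ExtZ R A Y i := by
  refine ⟨fun x y => ?_⟩
  suffices ∀ x : Ext.{u} (ModuleCat.of R A) (ModuleCat.of R Y) i, x = 0 by
    rw [this x, this y]
  intro x
  obtain ⟨z, rfl⟩ := Ext.contravariant_sequence_exact₁ h.shortExact (ModuleCat.of R Y) x
    (add_comm 1 i) (hC.elim _ _)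
  rw [hB.elim z 0, Ext.comp_zero]

theorem ExtZ.cov_third {f : A →ₗ[R] B} {g : B →ₗ[R] C} (h : IsSES R f g) {i : ℕ}
    (hB : ExtZ R X B i) (hA : ExtZ R X A (i + 1)) : ExtZ R X C i := by
  refine ⟨fun x y => ?_⟩
  suffices ∀ x : Ext.{u} (ModuleCat.of R X) (ModuleCat.of R C) i, x = 0 by
    rw [this x, this y]
  intro x
  obtain ⟨z, rfl⟩ := Ext.covariant_sequence_exact₃ (ModuleCat.of R X) h.shortExact x
    rfl (hA.elim _ _)
  rw [hB.elim z 0, Ext.zero_comp]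

theorem ExtZ.cov_first {f : A →ₗ[R] B} {g : B →ₗ[R] C} (h : IsSES R f g) {i : ℕ}
    (hC : ExtZ R X C i) (hB : ExtZ R X B (i + 1)) : ExtZ R X A (i + 1) := by
  refine ⟨fun x y => ?_⟩
  suffices ∀ x : Ext.{u} (ModuleCat.of R X) (ModuleCat.of R A) (i + 1), x = 0 by
    rw [this x, this y]
  intro x
  obtain ⟨z, rfl⟩ := Ext.covariant_sequence_exact₁ (ModuleCat.of R X) h.shortExact x
    (hB.elim _ _) rfl
  rw [hC.elim z 0, Ext.zero_comp]

theorem ExtZ.of_projective [Module.Projective R A] (i : ℕ) : ExtZ R A Y (i + 1) := by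
  have : Projective (ModuleCat.of R A) := (IsProjective.iff_projective A).1 inferInstance
  exact HasProjectiveDimensionLT.subsingleton (ModuleCat.of R A) 1 (i + 1) (by omega) _

theorem ExtZ.of_injective [Module.Injective R Y] (i : ℕ) : ExtZ R A Y (i + 1) := by
  have : Injective (ModuleCat.of R Y) := Module.injective_object_of_injective_module (R := R) (M := Y)
  exact HasInjectiveDimensionLT.subsingleton (ModuleCat.of R Y) 1 (i + 1) (by omega) _

theorem projective_of_extZ (h : ∀ (Y : Type u) [AddCommGroup Y] [Module R Y], ExtZ R A Y 1) :
    Module.Projective R A := by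
  rw [IsProjective.iff_projective, projective_iff_subsingleton_ext_one]
  intro Y
  exact h Y

theorem injective_of_extZ (h : ∀ (A : Type u) [AddCommGroup A] [Module R A], ExtZ R A Y 1) :
    Module.Injective R Y := by
  have : Injective (ModuleCat.of R Y) := by
    rw [injective_iff_subsingleton_ext_one]
    intro A
    exact h A
  exact Module.injective_module_of_injective_object R Y

theorem ExtZ.of_extend {f : A →ₗ[R] B} {g : B →ₗ[R] C} (h : IsSES R f g)
    (hB : ExtZ R B Y 1) (hext : ∀ a : A →ₗ[R] Y, ∃ b : B →ₗ[R] Y, b.comp f = a) :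
    ExtZ R C Y 1 := by
  refine ⟨fun x y => ?_⟩
  suffices ∀ x : Ext.{u} (ModuleCat.of R C) (ModuleCat.of R Y) 1, x = 0 by
    rw [this x, this y]
  intro x
  obtain ⟨z, rfl⟩ := Ext.contravariant_sequence_exact₃ h.shortExact (ModuleCat.of R Y) x
    (hB.elim _ _) (add_comm 1 0)
  obtain ⟨a, rfl⟩ := Ext.addEquiv₀.symm.surjective z
  obtain ⟨b, hb⟩ := hext a.hom
  have : a = ModuleCat.ofHom f ≫ ModuleCat.ofHom b := by
    ext1; exact hb.symm
  rw [this]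
  have h2 := h.shortExact.extClass_comp_assoc (Ext.mk₀ (ModuleCat.ofHom b))
    (h := add_comm 1 0)
  rw [Ext.mk₀_comp_mk₀] at h2
  exact h2

theorem ExtZ.of_lift {f : A →ₗ[R] B} {g : B →ₗ[R] C} (h : IsSES R f g)
    (hB : ExtZ R X B 1) (hl : ∀ a : X →ₗ[R] C, ∃ b : X →ₗ[R] B, g.comp b = a) :
    ExtZ R X A 1 := by
  refine ⟨fun x y => ?_⟩
  suffices ∀ x : Ext.{u} (ModuleCat.of R X) (ModuleCat.of R A) 1, x = 0 by
    rw [this x, this y]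
  intro x
  obtain ⟨z, rfl⟩ := Ext.covariant_sequence_exact₁ (ModuleCat.of R X) h.shortExact x
    (hB.elim _ _) rfl
  obtain ⟨a, rfl⟩ := Ext.addEquiv₀.symm.surjective z
  obtain ⟨b, hb⟩ := hl a.hom
  have : a = ModuleCat.ofHom b ≫ ModuleCat.ofHom g := by
    ext1; exact hb.symm
  rw [this]
  simp only [Ext.addEquiv₀_symm_apply, ← Ext.mk₀_comp_mk₀]
  rw [Ext.comp_assoc_of_second_deg_zero]
  erw [h.shortExact.comp_extClass]
  simp

theorem ExtZ.lift {f : A →ₗ[R] B} {g : B →ₗ[R] C} (h : IsSES R f g)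
    (hA : ExtZ R X A 1) (a : X →ₗ[R] C) : ∃ b : X →ₗ[R] B, g.comp b = a := by
  obtain ⟨z, hz⟩ := Ext.covariant_sequence_exact₃ (ModuleCat.of R X) h.shortExact
    (Ext.mk₀ (ModuleCat.ofHom a)) rfl (hA.elim _ _)
  obtain ⟨b, rfl⟩ := Ext.addEquiv₀.symm.surjective z
  refine ⟨b.hom, ?_⟩
  simp only [Ext.addEquiv₀_symm_apply, Ext.mk₀_comp_mk₀] at hz
  have := Ext.addEquiv₀.symm.injective hz
  exact congrArg ModuleCat.Hom.hom this

theorem ExtZ.congr_left (e : A ≃ₗ[R] B) {i : ℕ} (h : ExtZ R A Y i) : ExtZ R B Y i := by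
  refine ⟨fun x y => ?_⟩
  suffices ∀ x : Ext.{u} (ModuleCat.of R B) (ModuleCat.of R Y) i, x = 0 by
    rw [this x, this y]
  intro x
  have h1 : (Ext.mk₀ (e.toModuleIso.inv)).comp ((Ext.mk₀ e.toModuleIso.hom).comp x (zero_add i)) (zero_add i) = x := by
    rw [Ext.mk₀_comp_mk₀_assoc, Iso.inv_hom_id, Ext.mk₀_id_comp]
  rw [← h1, h.elim (Ext.comp _ x _) 0]
  simp

end ExtWrap

section Homological

variable {R : Type u} [Ring R]

theorem PdLT.mono {A : Type u} [AddCommGroup A] [Module R A] {m n : ℕ} (h : PdLT R A m)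
    (hmn : m ≤ n) : PdLT R A n := fun Y _ _ i hi => h Y i (hmn.trans hi)

theorem isSES_ker {A B : Type u} [AddCommGroup A] [Module R A] [AddCommGroup B] [Module R B]
    (g : A →ₗ[R] B) (hg : Function.Surjective g) : IsSES R (LinearMap.ker g).subtype g := by
  refine ⟨Subtype.val_injective, ?_, hg⟩
  rw [LinearMap.exact_iff]; simp

theorem isSES_coker {A B : Type u} [AddCommGroup A] [Module R A] [AddCommGroup B] [Module R B]
    (f : A →ₗ[R] B) (hf : Function.Injective f) : IsSES R f (LinearMap.range f).mkQ := by
  refine ⟨hf, ?_, Submodule.mkQ_surjective _⟩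
  rw [LinearMap.exact_iff]; simp

theorem isSES_mkQ {A : Type u} [AddCommGroup A] [Module R A] (D : Submodule R A) :
    IsSES R D.subtype D.mkQ := by
  refine ⟨Subtype.val_injective, ?_, Submodule.mkQ_surjective _⟩
  rw [LinearMap.exact_iff]; simp

theorem exists_proj (A : Type u) [AddCommGroup A] [Module R A] :
    ∃ g : (A →₀ R) →ₗ[R] A, Function.Surjective g :=
  ⟨Finsupp.linearCombination R id, Finsupp.linearCombination_id_surjective R A⟩

theorem exists_inj (A : Type u) [AddCommGroup A] [Module R A] :
    ∃ (I : Type u) (_ : AddCommGroup I) (_ : Module R I) (f : A →ₗ[R] I),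
      Module.Injective R I ∧ Function.Injective f := by
  obtain ⟨⟨I, hI, f, hf⟩⟩ := CategoryTheory.EnoughInjectives.presentation (ModuleCat.of R A)
  refine ⟨I, inferInstance, inferInstance, f.hom, ?_, (ModuleCat.mono_iff_injective f).1 hf⟩
  have : CategoryTheory.Injective (ModuleCat.of R I) := hI
  exact Module.injective_module_of_injective_object R I

theorem PdLT.of_projective {A : Type u} [AddCommGroup A] [Module R A] [Module.Projective R A] :
    PdLT R A 1 := by
  intro Y _ _ i hi
  obtain ⟨j, rfl⟩ : ∃ j, i = j + 1 := ⟨i - 1, by omega⟩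
  exact ExtZ.of_projective j

theorem PdLT.third {A B C : Type u} [AddCommGroup A] [Module R A] [AddCommGroup B] [Module R B]
    [AddCommGroup C] [Module R C] {f : A →ₗ[R] B} {g : B →ₗ[R] C} (h : IsSES R f g) {m : ℕ}
    (hA : PdLT R A m) (hB : PdLT R B (m + 1)) : PdLT R C (m + 1) := by
  intro Y _ _ i hi
  obtain ⟨j, rfl⟩ : ∃ j, i = j + 1 := ⟨i - 1, by omega⟩
  exact ExtZ.third h (hA Y j (by omega)) (hB Y _ hi)

theorem PdLT.congr {A B : Type u} [AddCommGroup A] [Module R A] [AddCommGroup B] [Module R B]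
    (e : A ≃ₗ[R] B) {m : ℕ} (hA : PdLT R A m) : PdLT R B m :=
  fun Y _ _ i hi => (hA Y i hi).congr_left e

/-- If `Ext^m(K, -) = 0` then `pd K < m`. -/
theorem PdLT.of_ext {A : Type u} [AddCommGroup A] [Module R A] (m : ℕ)
    (h : ∀ (Y : Type u) [AddCommGroup Y] [Module R Y], ExtZ R A Y m) : PdLT R A m := by
  intro Y _ _ i hi
  obtain ⟨j, rfl⟩ := Nat.exists_eq_add_of_le hi
  clear hi
  induction j generalizing Y with
  | zero => exact h Y
  | succ j ih =>
    obtain ⟨I, _, _, f, hI, hf⟩ := exists_inj (R := R) Y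
    exact ExtZ.cov_first (isSES_coker f hf) (ih _) (ExtZ.of_injective _)

/-- All projectives have injective dimension at most `n`. -/
def ProjId (R : Type u) [Ring R] (n : ℕ) : Prop :=
  ∀ (A Q : Type u) [AddCommGroup A] [Module R A] [AddCommGroup Q] [Module R Q],
    Module.Projective R Q → ∀ i, n < i → ExtZ R A Q i

/-- The finitistic dimension is at most `n`. -/
theorem PdLT.bound {n : ℕ} (hR : ProjId R n) {A : Type u} [AddCommGroup A] [Module R A] {m : ℕ}
    (h : PdLT R A m) : PdLT R A (n + 1) := by
  induction m with
  | zero => exact h.mono (by omega)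
  | succ m ih =>
    by_cases hm : m ≤ n
    · exact h.mono (by omega)
    · refine ih (PdLT.of_ext m fun Y _ _ => ?_)
      obtain ⟨g, hg⟩ := exists_proj (R := R) Y
      exact ExtZ.cov_third (isSES_ker g hg) (hR _ _ inferInstance m (by omega)) (h _ _ le_rfl)

/-- Finite projective dimension implies injective dimension at most `n`. -/
theorem PdLT.idBound {n : ℕ} (hR : ProjId R n) {M : Type u} [AddCommGroup M] [Module R M] {m : ℕ}
    (h : PdLT R M (m + 1)) (A : Type u) [AddCommGroup A] [Module R A] (i : ℕ) (hi : n < i) :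
    ExtZ R A M i := by
  induction m generalizing M i with
  | zero =>
    have : Module.Projective R M := projective_of_extZ fun Y _ _ => h Y 1 le_rfl
    exact hR A M this i hi
  | succ m ih =>
    obtain ⟨g, hg⟩ := exists_proj (R := R) M
    refine ExtZ.cov_third (isSES_ker g hg) (hR _ _ inferInstance i hi) (ih ?_ (i + 1) (by omega))
    intro Y _ _ j hj
    obtain ⟨k, rfl⟩ : ∃ k, j = k + 1 := ⟨j - 1, by omega⟩
    exact ExtZ.first (isSES_ker g hg) (ExtZ.of_projective k) (h Y _ (by omega))

theorem GorensteinProjective.extZ {G Q : Type u} [AddCommGroup G] [Module R G]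
    [AddCommGroup Q] [Module R Q] (hG : GorensteinProjective R G) (hQ : Module.Projective R Q)
    (i : ℕ) : ExtZ R G Q (i + 1) := by
  obtain ⟨P, _, _, d, hP, hd, ⟨e⟩, hQe⟩ := hG
  refine ExtZ.congr_left e.symm ?_
  have ses : ∀ j : ℤ, ∃ g : P j →ₗ[R] LinearMap.ker (d (j + 1)),
      IsSES R (LinearMap.ker (d j)).subtype g := by
    intro j
    refine ⟨(d j).codRestrict _ fun x => LinearMap.mem_ker.2 ((hd j).apply_apply_eq_zero x), Subtype.val_injective, ?_, ?_⟩
    · intro x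
      rw [← LinearMap.mem_ker, LinearMap.ker_codRestrict]
      simp
    · rintro ⟨y, hy⟩
      obtain ⟨x, rfl⟩ := (hd j y).1 hy
      exact ⟨x, rfl⟩
  suffices ∀ (i : ℕ) (j : ℤ), ExtZ R (LinearMap.ker (d j)) Q (i + 1) from this i 0
  intro i
  induction i with
  | zero =>
    intro j
    obtain ⟨k, rfl⟩ : ∃ k, j = k + 1 + 1 + 1 := ⟨j - 3, by ring⟩
    obtain ⟨g, hg⟩ := ses (k + 1 + 1)
    refine ExtZ.of_extend hg (ExtZ.of_projective 0) fun a => ?_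
    have ha := hQe Q _ _ hQ k
      ((a.comp ((d (k + 1)).codRestrict (LinearMap.ker (d (k + 1 + 1)))
        fun x => LinearMap.mem_ker.2 ((hd (k + 1)).apply_apply_eq_zero x))))
    obtain ⟨b, hb⟩ := ha.1 (by
      ext x
      simp only [LinearMap.comp_apply, LinearMap.zero_apply]
      convert a.map_zero
      ext
      exact (hd k).apply_apply_eq_zero x)
    refine ⟨b, ?_⟩
    ext ⟨y, hy⟩
    obtain ⟨x, rfl⟩ := (hd (k + 1) y).1 hy
    exact LinearMap.congr_fun hb x
  | succ i ih =>
    intro j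
    obtain ⟨k, rfl⟩ : ∃ k, j = k + 1 := ⟨j - 1, by ring⟩
    obtain ⟨g, hg⟩ := ses k
    exact ExtZ.third hg (ih k) (ExtZ.of_projective _)

/-- Decomposition of resolutions. -/
theorem HasLeftResolutionLE.succ_iff
    {𝒢 : ∀ (N : Type u) [AddCommGroup N] [Module R N], Prop}
    {M : Type u} [AddCommGroup M] [Module R M] {n : ℕ} (h : HasLeftResolutionLE R 𝒢 M (n + 1)) :
    ∃ (G : Type u) (_ : AddCommGroup G) (_ : Module R G) (g : G →ₗ[R] M),
      𝒢 G ∧ Function.Surjective g ∧ HasLeftResolutionLE R 𝒢 (LinearMap.ker g) n := by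
  obtain ⟨G, _, _, d, π, hG, hn, hπ, h0, hd⟩ := h
  refine ⟨G 0, inferInstance, inferInstance, π, hG 0, hπ, fun i => G (i + 1), inferInstance,
    inferInstance, fun i => d (i + 1),
    (d 0).codRestrict _ fun x => LinearMap.mem_ker.2 (h0.apply_apply_eq_zero x), fun i => hG _, fun i hi => hn _ (by omega),
    ?_, ?_, fun i => hd _⟩
  · rintro ⟨y, hy⟩
    obtain ⟨x, rfl⟩ := (h0 y).1 hy
    exact ⟨x, rfl⟩
  · intro x
    rw [← LinearMap.mem_ker, LinearMap.ker_codRestrict]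
    exact hd 0 x

theorem HasLeftResolutionLE.zero_iff
    {𝒢 : ∀ (N : Type u) [AddCommGroup N] [Module R N], Prop}
    {M : Type u} [AddCommGroup M] [Module R M] (h : HasLeftResolutionLE R 𝒢 M 0) :
    ∃ (G : Type u) (_ : AddCommGroup G) (_ : Module R G) (_ : G ≃ₗ[R] M), 𝒢 G := by
  obtain ⟨G, _, _, d, π, hG, hn, hπ, h0, hd⟩ := h
  refine ⟨G 0, inferInstance, inferInstance, LinearEquiv.ofBijective π ⟨?_, hπ⟩, hG 0⟩
  rw [injective_iff_map_eq_zero]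
  intro x hx
  obtain ⟨y, rfl⟩ := (h0 x).1 hx
  have := hn 1 (by omega)
  rw [Subsingleton.elim y 0, map_zero]

theorem extZ_of_gp {Q : Type u} [AddCommGroup Q] [Module R Q] (hQ : Module.Projective R Q) (n : ℕ)
    (M : Type u) [AddCommGroup M] [Module R M]
    (h : HasLeftResolutionLE R (fun N _ _ => GorensteinProjective R N) M n) (i : ℕ) (hi : n < i) :
    ExtZ R M Q i := by
  induction n generalizing M i with
  | zero =>
    obtain ⟨G, _, _, e, hG⟩ := h.zero_iff
    obtain ⟨k, rfl⟩ : ∃ k, i = k + 1 := ⟨i - 1, by omega⟩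
    exact (hG.extZ hQ k).congr_left e
  | succ n ih =>
    obtain ⟨G, _, _, g, hG, hg, hk⟩ := h.succ_iff
    obtain ⟨k, rfl⟩ : ∃ k, i = k + 1 := ⟨i - 1, by omega⟩
    exact ExtZ.third (isSES_ker g hg) (ih _ hk k (by omega)) (hG.extZ hQ k)

theorem exists_of_sInf_le {S : Set ℕ} {n : ℕ} (h : sInf ((↑) '' S : Set ℕ∞) ≤ n) :
    ∃ m ∈ S, m ≤ n := by
  by_contra! hc
  have : ((n + 1 : ℕ) : ℕ∞) ≤ sInf ((↑) '' S : Set ℕ∞) := by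
    refine le_sInf ?_
    rintro _ ⟨m, hm, rfl⟩
    exact_mod_cast hc m hm
  have := this.trans h
  norm_cast at this
  omega

theorem projId_of_ggldim {n : ℕ} (h : GPgldim R ≤ n) : ProjId R n := by
  intro A Q _ _ _ _ hQ i hi
  have h1 : gpDim R A ≤ n := by
    refine le_trans (le_sSup ?_) h
    exact ⟨A, _, _, rfl⟩
  obtain ⟨m, hm, hmn⟩ := exists_of_sInf_le h1
  exact extZ_of_gp hQ m A hm i (by omega)

end Homological

section Eklof

variable {R : Type u} [Ring R]

theorem eklof {K Y : Type u} [AddCommGroup K] [Module R K] [AddCommGroup Y] [Module R Y]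
    (𝓕 : Set (Submodule R K)) (hbot : ⊥ ∈ 𝓕)
    (hchain : ∀ c ⊆ 𝓕, IsChain (· ≤ ·) c → c.Nonempty → sSup c ∈ 𝓕)
    (hstep : ∀ D ∈ 𝓕, D ≠ ⊤ → ∃ D' ∈ 𝓕, D < D' ∧ ExtZ R (D' ⧸ D.submoduleOf D') Y 1) :
    ExtZ R K Y 1 := by
  obtain ⟨I, _, _, f, hI, hf⟩ := exists_inj (R := R) Y
  have hs := isSES_coker f hf
  set p := (LinearMap.range f).mkQ with hp
  refine ExtZ.of_lift hs (ExtZ.of_injective 0) fun a => ?_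
  let s : Set (K →ₗ.[R] I) := {g | g.domain ∈ 𝓕 ∧ ∀ x : g.domain, p (g x) = a x}
  have hz : ∃ m, (⊥ : K →ₗ.[R] I) ≤ m ∧ Maximal (· ∈ s) m := by
    refine zorn_le_nonempty₀ s ?_ ⊥ ⟨hbot, ?_⟩
    · intro c hcs hc y hy
      have hdir : DirectedOn (· ≤ ·) c := hc.directedOn
      refine ⟨LinearPMap.sSup c hdir, ⟨?_, ?_⟩, fun z hz => LinearPMap.le_sSup hdir hz⟩
      · refine hchain _ ?_ ?_ ⟨_, y, hy, rfl⟩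
        · rintro _ ⟨g, hg, rfl⟩
          exact (hcs hg).1
        · rintro _ ⟨g, hg, rfl⟩ _ ⟨g', hg', rfl⟩ -
          exact (hc.total hg hg').imp (fun h => h.1) (fun h => h.1)
      · rintro ⟨x, hx⟩
        obtain ⟨g, hg, hxg⟩ := (LinearPMap.mem_domain_sSup_iff ⟨y, hy⟩ hdir).1 hx
        have := LinearPMap.sSup_apply hdir hg ⟨x, hxg⟩
        exact (congrArg p this).trans ((hcs hg).2 ⟨x, hxg⟩)
    · rintro ⟨x, hx⟩
      have : x = 0 := hx
      subst this
      rw [map_zero]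
      exact (congrArg p (LinearPMap.map_zero ⊥)).trans (map_zero p)
  obtain ⟨m, -, ⟨hm, hmax⟩⟩ := hz
  have htop : m.domain = ⊤ := by
    by_contra hne
    obtain ⟨D', hD', hlt, hext⟩ := hstep _ hm.1 hne
    -- extend
    obtain ⟨g0, hg0⟩ := Module.Injective.out (R := R) (Submodule.inclusion hlt.le)
      (Submodule.inclusion_injective hlt.le) m.toFun
    let h0 : D' →ₗ[R] (I ⧸ LinearMap.range f) := p.comp g0 - a.comp D'.subtype
    have hker : m.domain.submoduleOf D' ≤ LinearMap.ker h0 := by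
      rintro ⟨x, hx'⟩ hx
      have hx : x ∈ m.domain := hx
      have h1 := hg0 ⟨x, hx⟩
      have h2 := hm.2 ⟨x, hx⟩
      simp only [h0, LinearMap.mem_ker, LinearMap.sub_apply, LinearMap.comp_apply]
      rw [sub_eq_zero]
      exact (congrArg p h1).trans h2
    obtain ⟨b, hb⟩ := ExtZ.lift hs hext ((m.domain.submoduleOf D').liftQ h0 hker)
    let g1 : D' →ₗ[R] I := g0 - b.comp (m.domain.submoduleOf D').mkQ
    have hle : m ≤ ⟨D', g1⟩ := by
      refine ⟨hlt.le, ?_⟩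
      rintro ⟨x, hx⟩ ⟨y, hy⟩ hxy
      have hxy : x = y := hxy
      subst hxy
      have h1 := hg0 ⟨x, hx⟩
      have h2 : (m.domain.submoduleOf D').mkQ ⟨x, hy⟩ = 0 := by
        exact (Submodule.Quotient.mk_eq_zero _).2 hx
      change m.toFun ⟨x, hx⟩ = g0 ⟨x, hy⟩ - b ((m.domain.submoduleOf D').mkQ ⟨x, hy⟩)
      rw [h2, map_zero, sub_zero]
      exact h1.symm
    have := hmax (y := ⟨D', g1⟩) ⟨hD', fun x => ?_⟩ hle
    · exact absurd this.1 (not_le_of_gt hlt)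
    · have h3 := LinearMap.congr_fun hb ((m.domain.submoduleOf D').mkQ x)
      have h3' : p (b ((m.domain.submoduleOf D').mkQ x)) = h0 x := by simpa using h3
      change p (g0 x - b ((m.domain.submoduleOf D').mkQ x)) = a x
      rw [map_sub, h3']
      simp [h0]
  refine ⟨m.toFun.comp ((LinearMap.id : K →ₗ[R] K).codRestrict m.domain (by simp [htop])), ?_⟩
  ext x
  exact hm.2 ⟨x, _⟩

theorem eklof_pd {K : Type u} [AddCommGroup K] [Module R K] (n : ℕ)
    (𝓕 : Set (Submodule R K)) (hbot : ⊥ ∈ 𝓕)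
    (hchain : ∀ c ⊆ 𝓕, IsChain (· ≤ ·) c → c.Nonempty → sSup c ∈ 𝓕)
    (hstep : ∀ D ∈ 𝓕, D ≠ ⊤ → ∃ D' ∈ 𝓕, D < D' ∧ PdLT R (D' ⧸ D.submoduleOf D') (n + 1)) :
    PdLT R K (n + 1) := by
  choose! E hE hlt hpd using hstep
  suffices ∀ (n : ℕ) (Y : Type u) [AddCommGroup Y] [Module R Y],
      (∀ D ∈ 𝓕, D ≠ ⊤ → ExtZ R (E D ⧸ D.submoduleOf (E D)) Y (n + 1)) → ExtZ R K Y (n + 1) from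
    PdLT.of_ext _ fun Y _ _ => this n Y fun D hD hD' => hpd D hD hD' Y _ le_rfl
  intro n
  induction n with
  | zero =>
    intro Y _ _ h
    exact eklof 𝓕 hbot hchain fun D hD hD' => ⟨E D, hE D hD hD', hlt D hD hD', h D hD hD'⟩
  | succ n ih =>
    intro Y _ _ h
    obtain ⟨I, _, _, f, hI, hf⟩ := exists_inj (R := R) Y
    refine ExtZ.cov_first (isSES_coker f hf) (ih _ fun D hD hD' => ?_) (ExtZ.of_injective _)
    exact ExtZ.cov_third (isSES_coker f hf) (ExtZ.of_injective _) (h D hD hD')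

end Eklof

section LocSplit

open Cardinal

variable {R : Type u} [Ring R]

/-- Local splitting data for a map `j : K → P`. -/
structure LocData {K P : Type u} [AddCommGroup K] [Module R K] [AddCommGroup P] [Module R P]
    (j : K →ₗ[R] P) where
  T : Finset K → Finset K
  φ : Finset K → (P →ₗ[R] K)
  fix : ∀ S, ∀ x ∈ S, φ S (j x) = x
  rng : ∀ S p, φ S p ∈ Submodule.span R (T S : Set K)
  emp : T ∅ = ∅

variable {K P : Type u} [AddCommGroup K] [Module R K] [AddCommGroup P] [Module R P]
  {j : K →ₗ[R] P}

theorem exists_locData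
    (h : ∀ x : K, ∃ (φ : P →ₗ[R] K) (T : Finset K), φ (j x) = x ∧
      ∀ p, φ p ∈ Submodule.span R (T : Set K)) : Nonempty (LocData j) := by
  classical
  have : ∀ S : Finset K, ∃ (φ : P →ₗ[R] K) (T : Finset K), (∀ x ∈ S, φ (j x) = x) ∧
      (∀ p, φ p ∈ Submodule.span R (T : Set K)) ∧ (S = ∅ → T = ∅) := by
    intro S
    induction S using Finset.induction_on with
    | empty => exact ⟨0, ∅, by simp⟩
    | insert a S ha ih =>
      obtain ⟨φ, T, h1, h2, -⟩ := ih
      obtain ⟨ψ, T', h3, h4⟩ := h (a - φ (j a))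
      refine ⟨φ + ψ - ψ.comp (j.comp φ), T ∪ T', ?_, ?_, by simp⟩
      · intro x hx
        rcases Finset.mem_insert.1 hx with rfl | hx
        · simp only [map_sub] at h3
          simp only [LinearMap.sub_apply, LinearMap.add_apply, LinearMap.comp_apply]
          rw [add_sub_assoc, h3]; abel
        · simp [h1 x hx]
      · intro p
        have e1 : Submodule.span R (T : Set K) ≤ Submodule.span R ((T ∪ T' : Finset K) : Set K) :=
          Submodule.span_mono (by simp)
        have e2 : Submodule.span R (T' : Set K) ≤ Submodule.span R ((T ∪ T' : Finset K) : Set K) :=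
          Submodule.span_mono (by simp)
        exact sub_mem (add_mem (e1 (h2 p)) (e2 (h4 p))) (e2 (h4 _))
  choose φ T h1 h2 h3 using this
  exact ⟨⟨T, φ, h1, h2, h3 _ rfl⟩⟩

namespace LocData

variable (L : LocData j)

/-- Closed sets. -/
def Closed (X : Set K) : Prop := ∀ S : Finset K, (S : Set K) ⊆ X → (L.T S : Set K) ⊆ X

/-- Closure of a set. -/
def cl (X : Set K) : Set K := ⋂₀ {W | L.Closed W ∧ X ⊆ W}

theorem subset_cl (X : Set K) : X ⊆ L.cl X := Set.subset_sInter fun _ h => h.2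

theorem cl_min {X W : Set K} (hW : L.Closed W) (h : X ⊆ W) : L.cl X ⊆ W :=
  Set.sInter_subset_of_mem ⟨hW, h⟩

theorem closed_cl (X : Set K) : L.Closed (L.cl X) := by
  intro S hS
  refine Set.subset_sInter fun W hW => hW.1 S (hS.trans (L.cl_min hW.1 hW.2))

theorem cl_mono {X Y : Set K} (h : X ⊆ Y) : L.cl X ⊆ L.cl Y :=
  L.cl_min (L.closed_cl Y) (h.trans (L.subset_cl Y))

theorem cl_empty : L.cl ∅ = ∅ := by
  refine Set.subset_empty_iff.1 (L.cl_min ?_ subset_rfl)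
  intro S hS
  have : S = ∅ := by simpa using hS
  subst this
  simp [L.emp]

theorem closed_iUnion {ι : Type*} [Nonempty ι] (f : ι → Set K) (hf : Directed (· ⊆ ·) f)
    (h : ∀ i, L.Closed (f i)) : L.Closed (⋃ i, f i) := by
  intro S hS
  obtain ⟨i, hi⟩ := hf.exists_mem_subset_of_finset_subset_biUnion hS
  exact (h i S hi).trans (Set.subset_iUnion f i)

/-- One closure step. -/
def step (X : Set K) : Set K := X ∪ ⋃ S : Finset X, (L.T (S.map (Function.Embedding.subtype _)) : Set K)

theorem mk_step_le {X : Set K} {μ : Cardinal.{u}} (hμ : ℵ₀ ≤ μ) (hX : #X ≤ μ) : #(L.step X) ≤ μ := by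
  refine (mk_union_le _ _).trans (add_le_of_le hμ hX ?_)
  refine mk_iUnion_le_sum_mk.trans ?_
  have h1 : #(Finset X) ≤ μ := by
    rcases finite_or_infinite X with h | h
    · exact (mk_lt_aleph0 (α := Finset X)).le.trans hμ
    · rw [mk_finset_of_infinite]; exact hX
  calc _ ≤ Cardinal.sum fun _ : Finset X => ℵ₀ := sum_le_sum _ _ fun S => by
          exact (mk_lt_aleph0 (α := ((L.T _ : Finset K) : Set K))).le
    _ = #(Finset X) * ℵ₀ := by simp
    _ ≤ μ := mul_le_of_le hμ h1 hμ

theorem mk_cl_le {X : Set K} {μ : Cardinal.{u}} (hμ : ℵ₀ ≤ μ) (hX : #X ≤ μ) : #(L.cl X) ≤ μ := by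
  let f : ℕ → Set K := fun n => L.step^[n] X
  have hsucc : ∀ n, f (n + 1) = L.step (f n) := fun n => Function.iterate_succ_apply' _ _ _
  have hmono : Monotone f := monotone_nat_of_le_succ fun n => by
    rw [hsucc]; exact Set.subset_union_left
  have hcl : L.Closed (⋃ n, f n) := by
    intro S hS
    obtain ⟨i, hi⟩ := hmono.directed_le.exists_mem_subset_of_finset_subset_biUnion hS
    refine subset_trans ?_ (Set.subset_iUnion f (i + 1))
    rw [hsucc]
    refine subset_trans ?_ Set.subset_union_right
    classical
    have := Set.subset_iUnion (fun S : Finset (f i) =>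
      (L.T (S.map (Function.Embedding.subtype _)) : Set K)) (S.subtype (· ∈ f i))
    rwa [Finset.subtype_map_of_mem (fun x hx => hi hx)] at this
  have hcard : ∀ n, #(f n) ≤ μ := by
    intro n
    induction n with
    | zero => exact hX
    | succ n ih => rw [hsucc]; exact L.mk_step_le hμ ih
  have h1 : L.cl X ⊆ ⋃ n, f n := L.cl_min hcl (Set.subset_iUnion f 0)
  refine (mk_le_mk_of_subset h1).trans ?_
  have h2 := mk_iUnion_le_sum_mk_lift (f := f)
  rw [lift_id'.{0,u}] at h2
  refine h2.trans ?_
  calc _ ≤ Cardinal.sum fun _ : ℕ => μ := sum_le_sum _ _ hcard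
    _ = ℵ₀ * μ := by simp
    _ ≤ μ := mul_le_of_le hμ hμ le_rfl

theorem fix_span (S : Finset K) {x : K} (hx : x ∈ Submodule.span R (S : Set K)) :
    L.φ S (j x) = x := by
  have : Submodule.span R (S : Set K) ≤ LinearMap.eqLocus ((L.φ S).comp j) LinearMap.id :=
    Submodule.span_le.2 fun y hy => L.fix S y hy
  exact this hx

theorem projective_of_countable [Module.Projective R P] {X : Set K} (hX : L.Closed X)
    (hc : X.Countable) : Module.Projective R (Submodule.span R X) := by
  classical
  rcases X.eq_empty_or_nonempty with rfl | hne
  · rw [Submodule.span_empty]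
    infer_instance
  obtain ⟨e, rfl⟩ := hc.exists_eq_range hne
  set X := Set.range e with hXdef
  obtain ⟨S, hS0, hS⟩ : ∃ S : ℕ → Finset K, S 0 = {e 0} ∧
      ∀ n, S (n + 1) = S n ∪ L.T (S n) ∪ {e (n + 1)} :=
    ⟨fun n => Nat.rec {e 0} (fun n s => s ∪ L.T s ∪ {e (n + 1)}) n, rfl, fun n => rfl⟩
  have hSX : ∀ n : ℕ, ((S n : Finset K) : Set K) ⊆ X := by
    intro n
    induction n with
    | zero => simp [hS0, X]
    | succ n ih =>
      rw [hS]
      simp only [Finset.coe_union, Finset.coe_singleton, Set.union_subset_iff,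
        Set.singleton_subset_iff]
      exact ⟨⟨ih, hX _ ih⟩, ⟨_, rfl⟩⟩
  have hmono : Monotone S := monotone_nat_of_le_succ fun n => by
    rw [hS, Finset.union_assoc]; exact Finset.subset_union_left
  have hT : ∀ n : ℕ, ((L.T (S n) : Finset K) : Set K) ⊆ ((S (n + 1) : Finset K) : Set K) := by
    intro n
    rw [hS]
    intro x hx
    simp only [Finset.coe_union, Set.mem_union]
    exact Or.inl (Or.inr hx)
  have heS : ∀ n, e n ∈ S n := by
    intro n
    cases n with
    | zero => simp [hS0]
    | succ n => rw [hS]; simp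
  have hex : ∀ x ∈ Submodule.span R X, ∃ n, x ∈ Submodule.span R (S n : Set K) := by
    intro x hx
    have hU : X = ⋃ n, (S n : Set K) := by
      refine subset_antisymm ?_ (Set.iUnion_subset hSX)
      rintro _ ⟨n, rfl⟩
      exact Set.mem_iUnion.2 ⟨n, heS n⟩
    rw [hU, Submodule.span_iUnion, Submodule.mem_iSup_of_directed] at hx
    · exact hx
    · exact Monotone.directed_le fun a b hab => Submodule.span_mono (by exact_mod_cast hmono hab)
  have hsp : ∀ n p, L.φ (S n) p ∈ Submodule.span R (S (n + 1) : Set K) :=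
    fun n p => Submodule.span_mono (hT n) (L.rng _ _)
  let ψ : ℕ → (K →ₗ[R] P) := fun n => Nat.casesOn n (j.comp ((L.φ (S 0)).comp j))
    (fun n => j.comp ((L.φ (S (n + 1))).comp j) - j.comp ((L.φ (S n)).comp j))
  have hψ : ∀ n x, x ∈ Submodule.span R (S n : Set K) → ∀ m, n < m → ψ m x = 0 := by
    intro n x hx m hm
    obtain ⟨k, rfl⟩ : ∃ k, m = k + 1 := ⟨m - 1, by omega⟩
    have h1 := L.fix_span (S k) (Submodule.span_mono (by exact_mod_cast hmono (by omega : n ≤ k)) hx)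
    have h2 := L.fix_span (S (k + 1))
      (Submodule.span_mono (by exact_mod_cast hmono (by omega : n ≤ k + 1)) hx)
    simp [ψ, h1, h2]
  have hfin : ∀ x : Submodule.span R X, (Function.support fun n => ψ n (x : K)).Finite := by
    rintro ⟨x, hx⟩
    obtain ⟨n, hn⟩ := hex x hx
    refine (Set.finite_Iic n).subset fun m hm => ?_
    by_contra hlt
    exact hm (hψ n x hn m (not_le.1 hlt))
  let i : Submodule.span R X →ₗ[R] (ℕ →₀ P) :=
    { toFun := fun x => Finsupp.ofSupportFinite (fun n => ψ n (x : K)) (hfin x)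
      map_add' := fun x y => by
        ext n; simp [Finsupp.ofSupportFinite_coe]
      map_smul' := fun r x => by
        ext n; simp [Finsupp.ofSupportFinite_coe] }
  let s : (ℕ →₀ P) →ₗ[R] Submodule.span R X :=
    Finsupp.lsum ℕ fun n => (L.φ (S (n + 1))).codRestrict (Submodule.span R X)
      fun p => Submodule.span_mono (hSX _) (hsp _ p)
  haveI : Module.Projective R (ℕ →₀ P) :=
    Module.Projective.of_equiv (finsuppLequivDFinsupp R (ι := ℕ) (M := P)).symm
  refine Module.Projective.of_split i s ?_
  ext ⟨x, hx⟩
  obtain ⟨N, hN⟩ := hex x hx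
  have hpart : ∀ N, ∑ n ∈ Finset.range (N + 1), L.φ (S (n + 1)) (ψ n x) = L.φ (S N) (j x) := by
    intro N
    induction N with
    | zero =>
      simp only [zero_add, Finset.range_one, Finset.sum_singleton]
      exact L.fix_span (S 1) (hsp 0 _)
    | succ N ih =>
      rw [Finset.sum_range_succ, ih]
      have h1 : L.φ (S (N + 1 + 1)) (j (L.φ (S (N + 1)) (j x))) = L.φ (S (N + 1)) (j x) :=
        L.fix_span _ (hsp (N + 1) _)
      have h2 : L.φ (S (N + 1 + 1)) (j (L.φ (S N) (j x))) = L.φ (S N) (j x) :=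
        L.fix_span _ (Submodule.span_mono (by exact_mod_cast hmono (by omega)) (hsp N _))
      simp only [ψ, LinearMap.sub_apply, LinearMap.comp_apply, map_sub, h1, h2]
      abel
  have hsum : s (i ⟨x, hx⟩) = ∑ n ∈ Finset.range (N + 1),
      (L.φ (S (n + 1))).codRestrict (Submodule.span R X)
        (fun p => Submodule.span_mono (hSX _) (hsp _ p)) (ψ n x) := by
    simp only [s, Finsupp.lsum_apply]
    rw [Finsupp.sum_of_support_subset (s := Finset.range (N + 1))]
    · rfl
    · intro m hm
      rw [Finset.mem_range]
      by_contra hlt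
      rw [Finsupp.mem_support_iff] at hm
      exact hm (hψ N x hN m (by omega))
    · simp
  simp only [LinearMap.comp_apply, LinearMap.id_apply]
  rw [hsum]
  simp only [AddSubmonoidClass.coe_finset_sum, LinearMap.codRestrict_apply]
  rw [hpart N]
  exact L.fix_span _ hN

end LocData

end LocSplit

section MainInduction

open Cardinal

variable {R : Type u} [Ring R]

theorem pdLT_quot {n : ℕ} (hR : ProjId R n) {K : Type u} [AddCommGroup K] [Module R K]
    {D D' : Submodule R K} (hle : D ≤ D') (h : PdLT R D (n + 1)) (h' : PdLT R D' (n + 1)) :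
    PdLT R (D' ⧸ D.submoduleOf D') (n + 1) :=
  PdLT.bound hR (PdLT.third (isSES_mkQ (D.submoduleOf D'))
    (h.congr (Submodule.submoduleOfEquivOfLe hle).symm) (h'.mono (by omega)))

theorem eklof_sub {n : ℕ} (hR : ProjId R n) {K : Type u} [AddCommGroup K] [Module R K]
    (N : Submodule R K)
    (𝓕 : Set (Submodule R K)) (hbot : ⊥ ∈ 𝓕) (hN : ∀ D ∈ 𝓕, D ≤ N)
    (hchain : ∀ c ⊆ 𝓕, IsChain (· ≤ ·) c → c.Nonempty → sSup c ∈ 𝓕)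
    (hstep : ∀ D ∈ 𝓕, D ≠ N → ∃ D' ∈ 𝓕, D < D' ∧ PdLT R D (n + 1) ∧ PdLT R D' (n + 1)) :
    PdLT R N (n + 1) := by
  have hinj : Function.Injective (Submodule.map N.subtype) :=
    Submodule.map_injective_of_injective N.injective_subtype
  refine eklof_pd n {D : Submodule R N | D.map N.subtype ∈ 𝓕} (by simpa using hbot) ?_ ?_
  · intro c hc hch hne
    have := hchain (Submodule.map N.subtype '' c) (by rintro _ ⟨D, hD, rfl⟩; exact hc hD)
      (IsChain.image_of_map_rel (· ≤ ·) (· ≤ ·) _ (fun _ _ h => Submodule.map_mono h) hch) (hne.image _)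
    have e : Submodule.map N.subtype (sSup c) = sSup (Submodule.map N.subtype '' c) := by
      rw [(Submodule.gc_map_comap N.subtype).l_sSup, sSup_image]
    change Submodule.map N.subtype (sSup c) ∈ 𝓕
    rwa [e]
  · intro D hD hDt
    obtain ⟨D', hD', hlt, h1, h2⟩ := hstep _ hD fun h => hDt (hinj (by simpa using h))
    have e : (D'.comap N.subtype).map N.subtype = D' := by
      rw [Submodule.map_comap_subtype]; exact inf_eq_right.2 (hN _ hD')
    have hle : D ≤ D'.comap N.subtype := Submodule.map_le_iff_le_comap.1 hlt.le
    refine ⟨D'.comap N.subtype, ?_, lt_of_le_of_ne hle ?_, pdLT_quot hR hle ?_ ?_⟩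
    · change Submodule.map N.subtype _ ∈ 𝓕
      rwa [e]
    · intro h
      rw [h, e] at hlt
      exact lt_irrefl _ hlt
    · exact h1.congr (Submodule.equivMapOfInjective _ N.injective_subtype D).symm
    · refine PdLT.congr (Submodule.equivMapOfInjective _ N.injective_subtype _).symm ?_
      rwa [e]

theorem LocData.pdLT_span {n : ℕ} (hR : ProjId R n) {K P : Type u} [AddCommGroup K] [Module R K]
    [AddCommGroup P] [Module R P] [Module.Projective R P] {j : K →ₗ[R] P} (L : LocData j)
    (κ : Cardinal.{u}) : ∀ X : Set K, L.Closed X → #X = κ → PdLT R (Submodule.span R X) (n + 1) := by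
  induction κ using WellFoundedLT.induction with
  | _ κ ih =>
  intro X hX hκ
  rcases le_or_gt κ ℵ₀ with hc | hc
  · have := L.projective_of_countable hX (Cardinal.mk_le_aleph0_iff.1 (hκ.trans_le hc))
    exact PdLT.of_projective.mono (by omega)
  subst hκ
  obtain ⟨_, _, hord⟩ := Cardinal.exists_ord_eq_type_lt X
  have hsmall : ∀ Y : Set K, #Y < #X → PdLT R (Submodule.span R (L.cl Y)) (n + 1) := by
    intro Y hY
    refine ih _ ?_ (L.cl Y) (L.closed_cl Y) rfl
    exact (L.mk_cl_le (μ := max ℵ₀ #Y) (le_max_left _ _) (le_max_right _ _)).trans_lt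
      (max_lt hc hY)
  let D : LowerSet X → Submodule R K := fun I =>
    Submodule.span R (L.cl (Subtype.val '' (I : Set X)))
  have hDmono : Monotone D := fun I J h =>
    Submodule.span_mono (L.cl_mono (Set.image_mono h))
  have hDle : ∀ I, D I ≤ Submodule.span R X := fun I =>
    Submodule.span_mono (L.cl_min hX (by rintro _ ⟨x, _, rfl⟩; exact x.2))
  refine eklof_sub hR _ (Set.range D) ⟨⊥, ?_⟩ (by rintro _ ⟨I, rfl⟩; exact hDle I) ?_ ?_
  · simp [D, L.cl_empty]
  · intro c hc hch hne
    let c' : Set (LowerSet X) := D ⁻¹' c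
    have hne' : c'.Nonempty := by
      obtain ⟨d, hd⟩ := hne
      obtain ⟨I, rfl⟩ := hc hd
      exact ⟨I, hd⟩
    haveI := hne'.to_subtype
    refine ⟨sSup c', le_antisymm ?_ (sSup_le ?_)⟩
    · have h1 : L.cl (Subtype.val '' ((sSup c' : LowerSet X) : Set X)) ⊆
          ⋃ I : c', L.cl (Subtype.val '' ((I : LowerSet X) : Set X)) := by
        refine L.cl_min (L.closed_iUnion _ ?_ fun I => L.closed_cl _) ?_
        · intro I J
          rcases le_total (I : LowerSet X) J with h | h
          · exact ⟨J, L.cl_mono (Set.image_mono h), subset_rfl⟩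
          · exact ⟨I, subset_rfl, L.cl_mono (Set.image_mono h)⟩
        · rintro _ ⟨x, hx, rfl⟩
          obtain ⟨I, hI, hxI⟩ := LowerSet.mem_sSup_iff.1 hx
          exact Set.mem_iUnion.2 ⟨⟨I, hI⟩, L.subset_cl _ ⟨x, hxI, rfl⟩⟩
      refine (Submodule.span_mono h1).trans ?_
      rw [Submodule.span_iUnion]
      exact iSup_le fun I => le_sSup I.2
    · intro d hd
      obtain ⟨I, rfl⟩ := hc hd
      exact hDmono (le_sSup hd)
  · rintro _ ⟨I, rfl⟩ hI
    obtain ⟨a, ha⟩ : ∃ a : X, (a : K) ∉ D I := by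
      by_contra! h
      exact hI (le_antisymm (hDle I) (Submodule.span_le.2 fun x hx => h ⟨x, hx⟩))
    have haI : ∀ b ∈ I, b < a := by
      intro b hb
      by_contra hba
      exact ha (Submodule.subset_span (L.subset_cl _ ⟨a, I.lower (not_lt.1 hba) hb, rfl⟩))
    have hlt : D I < D (LowerSet.Iic a) := by
      refine lt_of_le_of_ne (hDmono fun b hb => (haI b hb).le) fun h => ha ?_
      rw [h]
      exact Submodule.subset_span (L.subset_cl _ ⟨a, le_rfl, rfl⟩)
    have hmk : ∀ J : LowerSet X, J ≤ LowerSet.Iic a → PdLT R (D J) (n + 1) := by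
      intro J hJ
      refine hsmall _ (mk_image_le.trans_lt ((mk_le_mk_of_subset hJ).trans_lt ?_))
      exact Cardinal.mk_Iic_lt a hord hc.le
    exact ⟨_, ⟨_, rfl⟩, hlt, hmk _ fun b hb => (haI b hb).le, hmk _ le_rfl⟩

theorem LocData.pdLT {n : ℕ} (hR : ProjId R n) {K P : Type u} [AddCommGroup K] [Module R K]
    [AddCommGroup P] [Module R P] [Module.Projective R P] {j : K →ₗ[R] P} (L : LocData j) :
    PdLT R K (n + 1) := by
  have := L.pdLT_span hR _ Set.univ (fun _ _ => Set.subset_univ _) rfl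
  rw [Submodule.span_univ] at this
  exact this.congr Submodule.topEquiv

end MainInduction

section Flat

open TensorProduct

variable {R : Type u} [Ring R]

/-- The pure tensor in `N ⊗_R M`. -/
noncomputable def bt (N : Type u) [AddCommGroup N] [Module Rᵐᵒᵖ N]
    (M : Type u) [AddCommGroup M] [Module R M] : N ⊗[ℤ] M →+ bTensor R N M :=
  QuotientAddGroup.mk' (tensorRel R N M)

theorem bt_smul (N : Type u) [AddCommGroup N] [Module Rᵐᵒᵖ N]
    (M : Type u) [AddCommGroup M] [Module R M] (r : R) (a : N) (m : M) :
    bt (R := R) N M ((MulOpposite.op r • a) ⊗ₜ[ℤ] m) = bt (R := R) N M (a ⊗ₜ[ℤ] (r • m)) := by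
  rw [← sub_eq_zero, ← map_sub]
  exact (QuotientAddGroup.eq_zero_iff _).2 (AddSubgroup.subset_closure ⟨r, a, m, rfl⟩)

theorem tmapLeft_bt {N N' : Type u} [AddCommGroup N] [Module Rᵐᵒᵖ N]
    [AddCommGroup N'] [Module Rᵐᵒᵖ N'] (M : Type u) [AddCommGroup M] [Module R M]
    (g : N →ₗ[Rᵐᵒᵖ] N') (a : N) (m : M) :
    tmapLeft R M g (bt (R := R) N M (a ⊗ₜ[ℤ] m)) = bt (R := R) N' M (g a ⊗ₜ[ℤ] m) := rfl

theorem exists_btLift {N : Type u} [AddCommGroup N] [Module Rᵐᵒᵖ N]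
    {M : Type u} [AddCommGroup M] [Module R M] {V : Type u} [AddCommGroup V]
    (β : N →+ M →+ V) (h : ∀ (r : R) a m, β (MulOpposite.op r • a) m = β a (r • m)) :
    ∃ γ : bTensor R N M →+ V, ∀ a m, γ (bt (R := R) N M (a ⊗ₜ[ℤ] m)) = β a m := by
  have hz : ∀ (r : ℤ) a m, β (r • a) m = β a (r • m) := by
    intro r a m; rw [map_zsmul, map_zsmul]; rfl
  refine ⟨QuotientAddGroup.lift (tensorRel R N M) (TensorProduct.liftAddHom β hz) ?_, ?_⟩
  · rw [tensorRel, AddSubgroup.closure_le]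
    rintro _ ⟨r, a, m, rfl⟩
    simp only [SetLike.mem_coe, AddMonoidHom.mem_ker, map_sub]
    rw [sub_eq_zero]
    exact h r a m
  · intro a m
    rfl

theorem ModFlat.exists_loc {F : Type u} [AddCommGroup F] [Module R F] (hF : ModFlat R F)
    (x : F →₀ R) (hx : Finsupp.linearCombination R (id : F → F) x = 0) :
    ∃ w : F → (F →₀ R), (∀ b ∈ x.support, Finsupp.linearCombination R (id : F → F) (w b) = b) ∧
      ∑ b ∈ x.support, x b • w b = 0 := by
  classical
  let ρ : (F →₀ R) →ₗ[Rᵐᵒᵖ] R :=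
    { toFun := fun a => ∑ b ∈ x.support, x b * a b
      map_add' := fun a a' => by simp [mul_add, Finset.sum_add_distrib]
      map_smul' := fun r a => by
        simp [Finset.sum_mul, mul_assoc] }
  let Γ : (F →₀ R) →+ F →+ (F → F) :=
    AddMonoidHom.mk' (fun a => AddMonoidHom.mk' (fun f b => a b • f)
      (fun f f' => by ext b; simp)) (fun a a' => by ext f b; simp [add_smul])
  have hΓ : ∀ a f b, Γ a f b = a b • f := fun _ _ _ => rfl
  let U : AddSubgroup (F → F) := AddSubgroup.closure {w | ∃ a f, ρ a = 0 ∧ w = Γ a f}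
  let Γ' : (F →₀ R) →+ F →+ ((F → F) ⧸ U) :=
    (AddMonoidHom.compHom (QuotientAddGroup.mk' U)).comp Γ
  let p : (F →₀ R) →+ LinearMap.range ρ := ρ.rangeRestrict.toAddMonoidHom
  have hp : Function.Surjective p := ρ.surjective_rangeRestrict
  have hker : p.ker ≤ Γ'.ker := by
    intro a ha
    have ha' : ρ a = 0 := congrArg Subtype.val (show p a = 0 from ha)
    refine AddMonoidHom.mem_ker.2 ?_
    ext f
    exact (QuotientAddGroup.eq_zero_iff _).2 (AddSubgroup.subset_closure ⟨a, f, ha', rfl⟩)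
  let β : LinearMap.range ρ →+ F →+ ((F → F) ⧸ U) := p.liftOfSurjective hp ⟨Γ', hker⟩
  have hβ : ∀ a, β (p a) = Γ' a := fun a =>
    AddMonoidHom.liftOfRightInverse_comp_apply p _ (Function.rightInverse_surjInv hp) ⟨Γ', hker⟩ a
  obtain ⟨γ, hγ⟩ := exists_btLift (R := R) β (by
    intro r y f
    obtain ⟨a, rfl⟩ := hp y
    have : MulOpposite.op r • p a = p (MulOpposite.op r • a) := by
      exact (map_smul ρ.rangeRestrict _ _).symm
    rw [this, hβ, hβ]
    change QuotientAddGroup.mk' U _ = QuotientAddGroup.mk' U _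
    congr 1
    ext b
    simp [hΓ, mul_smul])
  let t : bTensor R (LinearMap.range ρ) F :=
    ∑ b ∈ x.support, bt (R := R) (LinearMap.range ρ) F (p (Finsupp.single b 1) ⊗ₜ[ℤ] b)
  have hρ : ∀ b, ρ (Finsupp.single b 1) = x b := by
    intro b
    change ∑ c ∈ x.support, x c * (Finsupp.single b (1 : R)) c = x b
    simp [Finsupp.single_apply]
    intro h; exact h.symm
  have ht : t = 0 := by
    refine hF _ _ _ _ _ _ (LinearMap.range ρ).subtype Subtype.val_injective ?_
    rw [map_zero, map_sum]
    have : ∀ b ∈ x.support, tmapLeft R F (LinearMap.range ρ).subtype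
        (bt (R := R) (LinearMap.range ρ) F (p (Finsupp.single b 1) ⊗ₜ[ℤ] b)) =
        bt (R := R) R F (1 ⊗ₜ[ℤ] (x b • b)) := by
      intro b _
      rw [tmapLeft_bt, ← bt_smul]
      congr 2
      change ρ _ = _
      rw [hρ]
      simp
    rw [Finset.sum_congr rfl this, ← map_sum, ← TensorProduct.tmul_sum]
    rw [Finsupp.linearCombination_apply, Finsupp.sum] at hx
    simp only [id] at hx
    rw [hx, TensorProduct.tmul_zero, map_zero]
  have hU : (∑ b ∈ x.support, Γ (Finsupp.single b 1) b) ∈ U := by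
    have h1 := congrArg γ ht
    rw [map_zero, map_sum] at h1
    refine (QuotientAddGroup.eq_zero_iff _).1 ?_
    change QuotientAddGroup.mk' U _ = 0
    rw [map_sum, ← h1]
    refine Finset.sum_congr rfl fun b _ => ?_
    rw [hγ, hβ]
    rfl
  have key : ∀ w ∈ U, ∃ v : F → (F →₀ R),
      (∀ b, Finsupp.linearCombination R (id : F → F) (v b) = w b) ∧
      ∑ b ∈ x.support, x b • v b = 0 := by
    intro w hw
    induction hw using AddSubgroup.closure_induction with
    | mem w h =>
      obtain ⟨a, f, ha, rfl⟩ := h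
      refine ⟨fun b => Finsupp.single f (a b), fun b => by simp [hΓ], ?_⟩
      have ha' : ∑ b ∈ x.support, x b * a b = 0 := ha
      simp only [Finsupp.smul_single, smul_eq_mul]
      rw [← Finsupp.single_finset_sum, ha', Finsupp.single_zero]
    | zero => exact ⟨0, by simp⟩
    | add w w' _ _ h h' =>
      obtain ⟨v, h1, h2⟩ := h
      obtain ⟨v', h1', h2'⟩ := h'
      refine ⟨v + v', fun b => by simp [h1, h1'], ?_⟩
      simp [Finset.sum_add_distrib, h2, h2']
    | neg w _ h =>
      obtain ⟨v, h1, h2⟩ := h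
      refine ⟨-v, fun b => by simp [h1], ?_⟩
      simp [Finset.sum_neg_distrib, h2]
  obtain ⟨v, h1, h2⟩ := key _ hU
  refine ⟨v, fun b hb => ?_, h2⟩
  rw [h1, Finset.sum_apply]
  simp only [hΓ]
  rw [Finset.sum_eq_single b]
  · simp
  · intro c _ hc; simp [Finsupp.single_apply, hc]
  · intro h; exact absurd hb h

theorem ModFlat.pdLT {n : ℕ} (hR : ProjId R n) {F : Type u} [AddCommGroup F] [Module R F]
    (hF : ModFlat R F) : PdLT R F (n + 1) := by
  classical
  let π : (F →₀ R) →ₗ[R] F := Finsupp.linearCombination R id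
  have hπ : Function.Surjective π := Finsupp.linearCombination_id_surjective R F
  obtain ⟨L⟩ := exists_locData (K := LinearMap.ker π) (P := F →₀ R)
      (j := (LinearMap.ker π).subtype) (by
    rintro ⟨x, hx⟩
    obtain ⟨w, h1, h2⟩ := hF.exists_loc x hx
    let v : F → LinearMap.ker π := fun b =>
      if hb : b ∈ x.support then ⟨Finsupp.single b 1 - w b, by
        have := h1 b hb
        rw [LinearMap.mem_ker, map_sub]
        change _ - Finsupp.linearCombination R id (w b) = 0
        rw [this]; simp [π]⟩ else 0
    have hv : ∀ b ∈ x.support, (v b : F →₀ R) = Finsupp.single b 1 - w b := by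
      intro b hb; simp only [v, dif_pos hb]
    refine ⟨Finsupp.linearCombination R v, x.support.image v, ?_, ?_⟩
    · ext1
      change ((Finsupp.linearCombination R v x : LinearMap.ker π) : F →₀ R) = x
      rw [Finsupp.linearCombination_apply, Finsupp.sum, AddSubmonoidClass.coe_finset_sum]
      have : ∀ b ∈ x.support, ((x b • v b : LinearMap.ker π) : F →₀ R) =
          Finsupp.single b (x b) - x b • w b := by
        intro b hb
        rw [Submodule.coe_smul, hv b hb, smul_sub]; simp
      rw [Finset.sum_congr rfl this, Finset.sum_sub_distrib, h2, sub_zero]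
      exact x.sum_single
    · intro q
      rw [Finsupp.linearCombination_apply]
      refine Submodule.sum_mem _ fun b _ => Submodule.smul_mem _ _ ?_
      by_cases hb : b ∈ x.support
      · exact Submodule.subset_span (by
          rw [Finset.coe_image]; exact ⟨b, hb, rfl⟩)
      · have : v b = 0 := by simp only [v, dif_neg hb]
        rw [this]; exact Submodule.zero_mem _)
  exact PdLT.bound hR (PdLT.third (isSES_ker π hπ) (L.pdLT hR)
    (PdLT.of_projective.mono (by omega)))

theorem HasLeftResolutionLE.pdLT_of_flat {n : ℕ} (hR : ProjId R n) (m : ℕ) {M : Type u}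
    [AddCommGroup M] [Module R M]
    (h : HasLeftResolutionLE R (fun N _ _ => ModFlat R N) M m) : PdLT R M (n + 1) := by
  induction m generalizing M with
  | zero =>
    obtain ⟨G, _, _, e, hG⟩ := h.zero_iff
    exact (ModFlat.pdLT hR hG).congr e
  | succ m ih =>
    obtain ⟨G, _, _, g, hG, hg, hk⟩ := h.succ_iff
    exact PdLT.bound hR (PdLT.third (isSES_ker g hg) (ih hk)
      ((ModFlat.pdLT hR hG).mono (by omega)))

end Flat

section ProjFlat

open TensorProduct

variable {R : Type u} [Ring R]

theorem bt_hom_ext {N : Type u} [AddCommGroup N] [Module Rᵐᵒᵖ N]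
    {M : Type u} [AddCommGroup M] [Module R M] {V : Type u} [AddCommGroup V]
    {f g : bTensor R N M →+ V}
    (h : ∀ a m, f (bt (R := R) N M (a ⊗ₜ[ℤ] m)) = g (bt (R := R) N M (a ⊗ₜ[ℤ] m))) (y) :
    f y = g y := by
  obtain ⟨z, rfl⟩ := QuotientAddGroup.mk'_surjective (tensorRel R N M) y
  change f (bt (R := R) N M z) = g (bt (R := R) N M z)
  induction z using TensorProduct.induction_on with
  | zero => simp only [map_zero]
  | tmul a m => exact h a m
  | add z z' h1 h2 => simp only [map_add, h1, h2]

theorem modFlat_of_projective (M : Type u) [AddCommGroup M] [Module R M] [Module.Projective R M] :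
    ModFlat R M := by
  classical
  obtain ⟨s, hs⟩ := Module.projective_def'.1 (inferInstance : Module.Projective R M)
  have hs' : ∀ m, (s m).sum (fun b r => r • b) = m := by
    intro m
    have := LinearMap.congr_fun hs m
    simpa [Finsupp.linearCombination_apply] using this
  have hΘ : ∀ (N : Type u) [AddCommGroup N] [Module Rᵐᵒᵖ N], ∃ Θ : bTensor R N M →+ (M →₀ N),
      ∀ a m b, Θ (bt (R := R) N M (a ⊗ₜ[ℤ] m)) b = MulOpposite.op (s m b) • a := by
    intro N _ _
    let β : N →+ M →+ (M →₀ N) :=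
      AddMonoidHom.mk' (fun a => AddMonoidHom.mk'
        (fun m => (s m).mapRange (fun r => MulOpposite.op r • a) (by simp))
        (fun m m' => by ext b; simp [add_smul])) (fun a a' => by ext m b; simp)
    have hβ : ∀ a m b, β a m b = MulOpposite.op (s m b) • a := fun a m b => by simp [β]
    obtain ⟨Θ, h⟩ := exists_btLift (R := R) β (by
      intro r a m
      ext b
      rw [hβ, hβ, smul_smul, map_smul, Finsupp.smul_apply, smul_eq_mul, MulOpposite.op_mul])
    exact ⟨Θ, fun a m b => by rw [h, hβ]⟩
  intro N N' _ _ _ _ g hg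
  obtain ⟨Θ, h1⟩ := hΘ N
  obtain ⟨Θ', h2⟩ := hΘ N'
  let Ψ : (M →₀ N) →+ bTensor R N M := Finsupp.liftAddHom fun m =>
    (bt (R := R) N M).comp ((TensorProduct.mk ℤ N M).flip m).toAddMonoidHom
  have hΨ : ∀ y, (Ψ.comp Θ) y = AddMonoidHom.id _ y := by
    refine bt_hom_ext fun a m => ?_
    have e : Θ (bt (R := R) N M (a ⊗ₜ[ℤ] m)) =
        (s m).mapRange (fun r => MulOpposite.op r • a) (by simp) := by
      ext b; rw [h1]; simp
    change Ψ (Θ _) = _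
    rw [e]
    simp only [Ψ, Finsupp.liftAddHom_apply]
    rw [Finsupp.sum_mapRange_index (by simp)]
    have e2 : ∀ b r, ((bt (R := R) N M).comp ((TensorProduct.mk ℤ N M).flip b).toAddMonoidHom)
        (MulOpposite.op r • a) = bt (R := R) N M (a ⊗ₜ[ℤ] (r • b)) := fun b r => bt_smul _ _ _ _ _
    simp only [e2]
    rw [Finsupp.sum, ← map_sum, ← TensorProduct.tmul_sum]
    change bt (R := R) N M (a ⊗ₜ[ℤ] ((s m).sum fun b r => r • b)) = _
    rw [hs']
    rfl
  have hnat : ∀ y, (Θ'.comp (tmapLeft R M g)) y =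
      ((Finsupp.mapRange.addMonoidHom g.toAddMonoidHom).comp Θ) y := by
    refine bt_hom_ext fun a m => ?_
    ext b
    change Θ' (tmapLeft R M g _) b = g (Θ _ b)
    rw [tmapLeft_bt, h2, h1, map_smul]
  rw [injective_iff_map_eq_zero]
  intro y hy
  have h3 : Θ y = 0 := by
    have := hnat y
    rw [AddMonoidHom.comp_apply, hy, map_zero] at this
    ext b
    refine hg ?_
    have h4 := DFunLike.congr_fun this.symm b
    rw [Finsupp.zero_apply, map_zero]
    exact h4
  have := hΨ y
  rw [AddMonoidHom.comp_apply, h3, map_zero] at this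
  exact this.symm

theorem HasLeftResolutionLE.imp {𝒢 𝒢' : ∀ (N : Type u) [AddCommGroup N] [Module R N], Prop}
    (hi : ∀ (N : Type u) [AddCommGroup N] [Module R N], 𝒢 N → 𝒢' N)
    {M : Type u} [AddCommGroup M] [Module R M] {n : ℕ} (h : HasLeftResolutionLE R 𝒢 M n) :
    HasLeftResolutionLE R 𝒢' M n := by
  obtain ⟨G, _, _, d, π, hG, hn, hπ, h0, hd⟩ := h
  exact ⟨G, inferInstance, inferInstance, d, π, fun i => hi _ (hG i), hn, hπ, h0, hd⟩

/-- Prepend a type to a sequence of types. -/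
def consT (A : Type u) (G : ℕ → Type u) : ℕ → Type u
  | 0 => A
  | i + 1 => G i

instance consAdd (A : Type u) (G : ℕ → Type u) [a : AddCommGroup A] [b : ∀ i, AddCommGroup (G i)] :
    ∀ i, AddCommGroup (consT A G i)
  | 0 => a
  | i + 1 => b i

instance consMod (A : Type u) (G : ℕ → Type u) [AddCommGroup A] [∀ i, AddCommGroup (G i)]
    [a : Module R A] [b : ∀ i, Module R (G i)] : ∀ i, Module R (consT A G i)
  | 0 => a
  | i + 1 => b i

/-- Prepend a map to a decreasing sequence of maps. -/
def consL (A : Type u) (G : ℕ → Type u) [AddCommGroup A] [∀ i, AddCommGroup (G i)]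
    [Module R A] [∀ i, Module R (G i)] (π : G 0 →ₗ[R] A) (d : ∀ i, G (i + 1) →ₗ[R] G i) :
    ∀ i, consT A G (i + 1) →ₗ[R] consT A G i
  | 0 => π
  | i + 1 => d i

/-- Prepend a map to an increasing sequence of maps. -/
def consR (A : Type u) (G : ℕ → Type u) [AddCommGroup A] [∀ i, AddCommGroup (G i)]
    [Module R A] [∀ i, Module R (G i)] (π : A →ₗ[R] G 0) (d : ∀ i, G i →ₗ[R] G (i + 1)) :
    ∀ i, consT A G i →ₗ[R] consT A G (i + 1)
  | 0 => π
  | i + 1 => d i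

theorem PdLT.leftRes (n : ℕ) {M : Type u} [AddCommGroup M] [Module R M] (h : PdLT R M (n + 1)) :
    HasLeftResolutionLE R (fun N _ _ => Module.Projective R N) M n := by
  induction n generalizing M with
  | zero =>
    have hM : Module.Projective R M := projective_of_extZ fun Y _ _ => h Y 1 le_rfl
    refine ⟨consT M (fun _ => PUnit), inferInstance, inferInstance, fun i => 0,
      (LinearMap.id : M →ₗ[R] M), ?_, ?_, ?_, ?_, ?_⟩
    · rintro (_ | i)
      · exact hM
      · exact (inferInstance : Module.Projective R PUnit.{u + 1})
    · rintro (_ | i) hi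
      · omega
      · exact (inferInstance : Subsingleton PUnit)
    · exact fun x => ⟨x, rfl⟩
    · intro x
      refine ⟨fun hx => ⟨0, hx.symm⟩, ?_⟩
      rintro ⟨_, rfl⟩
      rfl
    · intro i x
      exact ⟨fun _ => ⟨0, (inferInstance : Subsingleton PUnit).elim _ _⟩, fun _ => rfl⟩
  | succ n ih =>
    obtain ⟨g, hg⟩ := exists_proj (R := R) M
    obtain ⟨G, i1, i2, d, π, hG, hn, hπ, h0, hd⟩ := ih (M := LinearMap.ker g) (by
      intro Y _ _ j hj
      obtain ⟨k, rfl⟩ : ∃ k, j = k + 1 := ⟨j - 1, by omega⟩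
      exact ExtZ.first (isSES_ker g hg) (ExtZ.of_projective k) (h Y _ (by omega)))
    refine ⟨consT (M →₀ R) G, inferInstance, inferInstance,
      consL (M →₀ R) G ((LinearMap.ker g).subtype.comp π) d, g, ?_, ?_, hg, ?_, ?_⟩
    · rintro (_ | i)
      · exact (inferInstance : Module.Projective R (M →₀ R))
      · exact hG i
    · rintro (_ | i) hi
      · omega
      · exact hn i (by omega)
    · intro x
      constructor
      · intro hx
        obtain ⟨y, hy⟩ := hπ ⟨x, hx⟩
        exact ⟨y, congrArg Subtype.val hy⟩
      · rintro ⟨y, rfl⟩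
        exact (π y).2
    · rintro (_ | i)
      · intro x
        exact (Subtype.ext_iff (a1 := π x) (a2 := 0)).symm.trans (h0 x)
      · exact hd i

theorem rightRes (n : ℕ) {M : Type u} [AddCommGroup M] [Module R M]
    (h : ∀ (A : Type u) [AddCommGroup A] [Module R A] (i : ℕ), n < i → ExtZ R A M i) :
    HasRightResolutionLE R (fun N _ _ => Module.Injective R N) M n := by
  induction n generalizing M with
  | zero =>
    have hM : Module.Injective R M := injective_of_extZ fun Y _ _ => h Y 1 (by omega)
    refine ⟨consT M (fun _ => PUnit), inferInstance, inferInstance, fun i => 0,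
      (LinearMap.id : M →ₗ[R] M), ?_, ?_, ?_, ?_, ?_⟩
    · rintro (_ | i)
      · exact hM
      · exact ⟨fun X Y _ _ _ _ f hf g => ⟨0, fun x => (inferInstance : Subsingleton PUnit).elim _ _⟩⟩
    · rintro (_ | i) hi
      · omega
      · exact (inferInstance : Subsingleton PUnit)
    · exact fun x y h => h
    · intro x
      exact ⟨fun _ => ⟨x, rfl⟩, fun _ => rfl⟩
    · intro i x
      exact ⟨fun _ => ⟨0, (inferInstance : Subsingleton PUnit).elim _ _⟩, fun _ => rfl⟩
  | succ n ih =>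
    obtain ⟨I, _, _, f, hI, hf⟩ := exists_inj (R := R) M
    obtain ⟨G, i1, i2, d, ι, hG, hn, hι, h0, hd⟩ := ih (M := I ⧸ LinearMap.range f) (by
      intro A _ _ i hi
      obtain ⟨k, rfl⟩ : ∃ k, i = k + 1 := ⟨i - 1, by omega⟩
      exact ExtZ.cov_third (isSES_coker f hf) (ExtZ.of_injective _) (h A _ (by omega)))
    refine ⟨consT I G, inferInstance, inferInstance,
      consR I G (ι.comp (LinearMap.range f).mkQ) d, f, ?_, ?_, hf, ?_, ?_⟩
    · rintro (_ | i)
      · exact hI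
      · exact hG i
    · rintro (_ | i) hi
      · omega
      · exact hn i (by omega)
    · have h3 : ∀ x : I, ι ((LinearMap.range f).mkQ x) = 0 ↔ x ∈ Set.range f := by
        intro x
        rw [map_eq_zero_iff ι hι, ← LinearMap.mem_ker, Submodule.ker_mkQ]
        rfl
      exact fun x => h3 x
    · rintro (_ | i)
      · intro x
        refine (h0 x).trans ?_
        constructor
        · rintro ⟨y, rfl⟩
          obtain ⟨z, rfl⟩ := (LinearMap.range f).mkQ_surjective y
          exact ⟨z, rfl⟩
        · rintro ⟨z, rfl⟩
          exact ⟨_, rfl⟩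
      · exact hd i

end ProjFlat

/-- If `l.Ggldim(R) ≤ n` and `M` has finite flat dimension, then `M` has finite
projective dimension, and `pd_R(M) ≤ n`, `id_R(M) ≤ n` and `fd_R(M) ≤ n`. -/
theorem dims_le_of_fDim_finite (R : Type u) [Ring R] (n : ℕ) (h : GPgldim R ≤ n)
    (M : Type u) [AddCommGroup M] [Module R M] (hM : fDim R M ≠ ⊤) :
    pDim R M ≠ ⊤ ∧ pDim R M ≤ n ∧ iDim R M ≤ n ∧ fDim R M ≤ n := by
  have hR : ProjId R n := projId_of_ggldim h
  have hm : ∃ m, HasLeftResolutionLE R (fun N _ _ => ModFlat R N) M m := by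
    by_contra! hno
    apply hM
    have he : {n : ℕ | HasLeftResolutionLE R (fun N _ _ => ModFlat R N) M n} = ∅ :=
      Set.eq_empty_iff_forall_notMem.2 hno
    rw [fDim, he, Set.image_empty, sInf_empty]
  obtain ⟨m, hm⟩ := hm
  have hpd : PdLT R M (n + 1) := HasLeftResolutionLE.pdLT_of_flat hR m hm
  have hl := hpd.leftRes
  have hr := rightRes n fun A _ _ i hi => hpd.idBound hR A i hi
  have hf : HasLeftResolutionLE R (fun N _ _ => ModFlat R N) M n :=
    HasLeftResolutionLE.imp (𝒢 := fun N _ _ => Module.Projective R N)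
      (𝒢' := fun N _ _ => ModFlat R N)
      (fun N _ _ hN => @modFlat_of_projective R _ N _ _ hN) hl
  have h1 : pDim R M ≤ n := by
    rw [pDim]; exact sInf_le (Set.mem_image_of_mem _ hl)
  have h2 : iDim R M ≤ n := by
    rw [iDim]; exact sInf_le (Set.mem_image_of_mem _ hr)
  have h3 : fDim R M ≤ n := by
    rw [fDim]; exact sInf_le (Set.mem_image_of_mem _ hf)
  exact ⟨ne_top_of_le_ne_top (ENat.natCast_ne_top n) h1, h1, h2, h3⟩
end

section
/- If 0 → K → N → M → 0 is a short exact sequence of R-modules with N Gorenstein projective, Gid_R(K) ≤ n, and Gid_R(N) ≤ n, then Gid_R(M) ≤ n. -/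
/-! Definitions for Gorenstein homological algebra over an arbitrary
associative ring `R` (left modules; right modules are `Rᵐᵒᵖ`-modules). -/

universe u

section GIAux

variable {R : Type u} [Ring R]

/-- Factor through a surjection. -/
theorem aux_desc {B C D : Type u} [AddCommGroup B] [Module R B] [AddCommGroup C] [Module R C]
    [AddCommGroup D] [Module R D] (g : B →ₗ[R] C) (hg : Function.Surjective g)
    (φ : B →ₗ[R] D) (h : ∀ b, g b = 0 → φ b = 0) :
    ∃ ψ : C →ₗ[R] D, ∀ b, ψ (g b) = φ b := by
  refine ⟨((LinearMap.ker g).liftQ φ (fun b hb => h b hb)).comp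
    (g.quotKerEquivOfSurjective hg).symm.toLinearMap, fun b => ?_⟩
  have : (g.quotKerEquivOfSurjective hg).symm (g b) = Submodule.Quotient.mk b := by
    rw [LinearEquiv.symm_apply_eq]; rfl
  change (LinearMap.ker g).liftQ φ (fun b hb => h b hb) ((g.quotKerEquivOfSurjective hg).symm (g b)) = φ b
  rw [this]
  exact Submodule.liftQ_apply _ _ _

/-- Factor through an injection. -/
theorem aux_lift {A B D : Type u} [AddCommGroup B] [Module R B] [AddCommGroup A] [Module R A]
    [AddCommGroup D] [Module R D] (i : A →ₗ[R] B) (hi : Function.Injective i)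
    (φ : D →ₗ[R] B) (h : ∀ d, ∃ a, i a = φ d) :
    ∃ ψ : D →ₗ[R] A, ∀ d, i (ψ d) = φ d := by
  refine ⟨(LinearEquiv.ofInjective i hi).symm.toLinearMap.comp
    (φ.codRestrict (LinearMap.range i) (fun d => h d)), fun d => ?_⟩
  have := LinearEquiv.apply_symm_apply (LinearEquiv.ofInjective i hi)
    (φ.codRestrict (LinearMap.range i) (fun d => h d) d)
  exact congrArg Subtype.val this

theorem inj_prod {I J : Type u} [AddCommGroup I] [Module R I] [AddCommGroup J] [Module R J]
    (hI : Module.Injective R I) (hJ : Module.Injective R J) : Module.Injective R (I × J) := by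
  refine ⟨fun X Y _ _ _ _ f hf g => ?_⟩
  obtain ⟨a, ha⟩ := hI.out f hf ((LinearMap.fst R I J).comp g)
  obtain ⟨b, hb⟩ := hJ.out f hf ((LinearMap.snd R I J).comp g)
  exact ⟨a.prod b, fun x => Prod.ext (ha x) (hb x)⟩

theorem inj_subsingleton {I : Type u} [AddCommGroup I] [Module R I] [Subsingleton I] :
    Module.Injective R I :=
  ⟨fun X Y _ _ _ _ f hf g => ⟨0, fun x => Subsingleton.elim _ _⟩⟩

/-- Lifting property of maps from injectives. -/
def ELift {B C : Type u} [AddCommGroup B] [Module R B] [AddCommGroup C] [Module R C]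
    (g : B →ₗ[R] C) : Prop :=
  ∀ (E : Type u) (_ : AddCommGroup E) (_ : Module R E), Module.Injective R E →
    ∀ h : E →ₗ[R] C, ∃ k : E →ₗ[R] B, ∀ e, g (k e) = h e

variable (R) in
/-- A proper short exact sequence with injective middle term. -/
def GStep (X Y : Type u) [AddCommGroup X] [Module R X] [AddCommGroup Y] [Module R Y] : Prop :=
  ∃ (I : Type u) (_ : AddCommGroup I) (_ : Module R I) (ι : X →ₗ[R] I) (p : I →ₗ[R] Y),
    Module.Injective R I ∧ IsSES R ι p ∧ ELift p

variable (R) in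
/-- A class of modules closed under steps in both directions. -/
def GClosed (P : ∀ (N : Type u) [AddCommGroup N] [Module R N], Prop) : Prop :=
  ∀ (X : Type u) [AddCommGroup X] [Module R X], P X →
    (∃ (Y : Type u) (_ : AddCommGroup Y) (_ : Module R Y), P Y ∧ GStep R X Y) ∧
    (∃ (Y : Type u) (_ : AddCommGroup Y) (_ : Module R Y), P Y ∧ GStep R Y X)

theorem GorensteinInjective.iso {A B : Type u} [AddCommGroup A] [Module R A]
    [AddCommGroup B] [Module R B] (e : A ≃ₗ[R] B) (h : GorensteinInjective R A) :
    GorensteinInjective R B := by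
  obtain ⟨I, i1, i2, d, h1, h2, ⟨e'⟩, h4⟩ := h
  exact ⟨I, i1, i2, d, h1, h2, ⟨e.symm.trans e'⟩, h4⟩

theorem chain_exists {S : Type*} (r : S → S → Prop) (hr : ∀ x, ∃ y, r x y)
    (hl : ∀ x, ∃ y, r y x) (x : S) : ∃ Z : ℤ → S, Z 0 = x ∧ ∀ i, r (Z i) (Z (i + 1)) := by
  choose a ha using hr
  choose b hb using hl
  refine ⟨fun i => match i with
    | Int.ofNat n => a^[n] x
    | Int.negSucc n => b^[n + 1] x, rfl, fun i => ?_⟩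
  rcases i with n | n
  · change r (a^[n] x) (a^[n + 1] x)
    rw [Function.iterate_succ_apply']
    exact ha _
  · rcases n with _ | n
    · exact hb _
    · change r (b^[n + 1 + 1] x) (b^[n + 1] x)
      rw [Function.iterate_succ_apply' b (n + 1)]
      exact hb _

theorem gi_of_closed (P : ∀ (N : Type u) [AddCommGroup N] [Module R N], Prop)
    (hP : GClosed R P) (M : Type u) [AddCommGroup M] [Module R M] (hM : P M) :
    GorensteinInjective R M := by
  let S := {X : ModuleCat.{u} R // P X}
  obtain ⟨Z, hZ0, hZ⟩ := chain_exists (S := S) (fun X Y => GStep R X.1 Y.1)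
    (fun X => by
      obtain ⟨Y, _, _, hY, h⟩ := (hP X.1 X.2).1
      exact ⟨⟨ModuleCat.of R Y, hY⟩, h⟩)
    (fun X => by
      obtain ⟨Y, _, _, hY, h⟩ := (hP X.1 X.2).2
      exact ⟨⟨ModuleCat.of R Y, hY⟩, h⟩) ⟨ModuleCat.of R M, hM⟩
  choose I i1 i2 ι p hI hs hl using hZ
  refine ⟨I, i1, i2, fun i => (ι (i + 1)).comp (p i), hI, fun i y => ?_, ?_, ?_⟩
  · constructor
    · intro hy
      have h1 : p (i + 1) y = 0 := (hs (i + 1 + 1)).1 (by simpa using hy)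
      obtain ⟨z, rfl⟩ := ((hs (i + 1)).2.1 y).1 h1
      obtain ⟨x, rfl⟩ := (hs i).2.2 z
      exact ⟨x, rfl⟩
    · rintro ⟨x, rfl⟩
      have : p (i + 1) (ι (i + 1) (p i x)) = 0 := ((hs (i + 1)).2.1 _).2 ⟨_, rfl⟩
      simp [this]
  · have e1 : M ≃ₗ[R] (Z 0).1 := by rw [hZ0]
    have hk : LinearMap.range (ι 0) = LinearMap.ker ((ι (0 + 1)).comp (p 0)) := by
      ext y
      constructor
      · rintro ⟨x, rfl⟩
        have : p 0 (ι 0 x) = 0 := ((hs 0).2.1 _).2 ⟨_, rfl⟩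
        simp only [LinearMap.mem_ker, LinearMap.comp_apply]
        rw [this, map_zero]
      · intro hy
        exact ((hs 0).2.1 y).1 ((hs (0 + 1)).1 (by rw [map_zero]; exact hy))
    exact ⟨e1.trans ((LinearEquiv.ofInjective (ι 0) (hs 0).1).trans (LinearEquiv.ofEq _ _ hk))⟩
  · intro E _ _ hE i y
    constructor
    · intro hy
      have h1 : ∀ e, p (i + 1) (y e) = 0 := fun e => (hs (i + 1 + 1)).1 (by
        rw [map_zero]; exact LinearMap.congr_fun hy e)
      obtain ⟨z, hz⟩ := aux_lift (ι (i + 1)) (hs (i + 1)).1 y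
        (fun e => ((hs (i + 1)).2.1 _).1 (h1 e))
      obtain ⟨x, hx⟩ := hl i E _ _ hE z
      refine ⟨x, LinearMap.ext fun e => ?_⟩
      simp [hx, hz]
    · rintro ⟨x, rfl⟩
      refine LinearMap.ext fun e => ?_
      have : p (i + 1) (ι (i + 1) (p i (x e))) = 0 := ((hs (i + 1)).2.1 _).2 ⟨_, rfl⟩
      simp [this]

theorem gi_closed_of (M : Type u) [AddCommGroup M] [Module R M]
    (h : GorensteinInjective R M) :
    ∃ P : ∀ (N : Type u) [AddCommGroup N] [Module R N], Prop, GClosed R P ∧ P M := by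
  obtain ⟨I, i1, i2, d, hI, hd, ⟨e⟩, hE⟩ := h
  have key : ∀ i (X Y : Type u) [AddCommGroup X] [Module R X] [AddCommGroup Y] [Module R Y]
      (_ : X ≃ₗ[R] LinearMap.ker (d i)) (_ : LinearMap.ker (d (i + 1)) ≃ₗ[R] Y),
      GStep R X Y := by
    intro i X Y _ _ _ _ a b
    have hm : ∀ x, d i x ∈ LinearMap.ker (d (i + 1)) := fun x => (hd i _).2 ⟨x, rfl⟩
    refine ⟨I i, i1 i, i2 i, (LinearMap.ker (d i)).subtype.comp a.toLinearMap,
      b.toLinearMap.comp ((d i).codRestrict _ hm), hI i, ⟨?_, ?_, ?_⟩, ?_⟩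
    · exact Subtype.val_injective.comp a.injective
    · intro y
      constructor
      · intro hy
        have h1 : (d i).codRestrict _ hm y = 0 := b.injective (by rw [map_zero]; exact hy)
        have h2 : d i y = 0 := congrArg Subtype.val h1
        exact ⟨a.symm ⟨y, h2⟩, by simp⟩
      · rintro ⟨x, rfl⟩
        have h1 : (d i).codRestrict _ hm ((a x : LinearMap.ker (d i)) : I i) = 0 :=
          Subtype.ext (a x).2
        change b _ = 0
        rw [← map_zero b]
        exact congrArg b h1
    · intro y
      obtain ⟨x, hx⟩ := (hd i _).1 (b.symm y).2
      refine ⟨x, ?_⟩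
      have : (d i).codRestrict _ hm x = b.symm y := Subtype.ext hx
      simp [this]
    · intro E _ _ hE' h
      obtain ⟨k, hk⟩ := (hE E _ _ hE' i
        ((LinearMap.ker (d (i + 1))).subtype.comp (b.symm.toLinearMap.comp h))).1
        (LinearMap.ext fun e => (b.symm (h e)).2)
      refine ⟨k, fun e => ?_⟩
      have : (d i).codRestrict _ hm (k e) = b.symm (h e) :=
        Subtype.ext (LinearMap.congr_fun hk e)
      simp [this]
  refine ⟨fun N _ _ => ∃ i, Nonempty (N ≃ₗ[R] LinearMap.ker (d i)), ?_, ⟨0, ⟨e⟩⟩⟩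
  rintro X _ _ ⟨i, ⟨a⟩⟩
  refine ⟨⟨LinearMap.ker (d (i + 1)), inferInstance, inferInstance,
    ⟨i + 1, ⟨LinearEquiv.refl R _⟩⟩, key i _ _ a (LinearEquiv.refl R _)⟩, ?_⟩
  obtain ⟨j, rfl⟩ : ∃ j, i = j + 1 := ⟨i - 1, by ring⟩
  exact ⟨LinearMap.ker (d j), inferInstance, inferInstance,
    ⟨j, ⟨LinearEquiv.refl R _⟩⟩, key j _ _ (LinearEquiv.refl R _) a.symm⟩

theorem gi_closed : GClosed R (fun N _ _ => GorensteinInjective R N) := by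
  intro X _ _ hX
  obtain ⟨P, hP, hPX⟩ := gi_closed_of X hX
  obtain ⟨⟨Y, _, _, hY, hs⟩, ⟨Y', _, _, hY', hs'⟩⟩ := hP X hPX
  exact ⟨⟨Y, _, _, gi_of_closed P hP Y hY, hs⟩, ⟨Y', _, _, gi_of_closed P hP Y' hY', hs'⟩⟩

theorem gi_of_steps (X : Type u) [AddCommGroup X] [Module R X]
    (h1 : ∃ (Y : Type u) (_ : AddCommGroup Y) (_ : Module R Y),
      GorensteinInjective R Y ∧ GStep R X Y)
    (h2 : ∃ (Y : Type u) (_ : AddCommGroup Y) (_ : Module R Y),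
      GorensteinInjective R Y ∧ GStep R Y X) : GorensteinInjective R X := by
  refine gi_of_closed (fun X _ _ => (∃ (Y : Type u) (_ : AddCommGroup Y) (_ : Module R Y),
      GorensteinInjective R Y ∧ GStep R X Y) ∧ (∃ (Y : Type u) (_ : AddCommGroup Y)
      (_ : Module R Y), GorensteinInjective R Y ∧ GStep R Y X)) ?_ X ⟨h1, h2⟩
  rintro X _ _ ⟨⟨Y, _, _, hY, hs⟩, ⟨Y', _, _, hY', hs'⟩⟩
  exact ⟨⟨Y, _, _, gi_closed Y hY, hs⟩, ⟨Y', _, _, gi_closed Y' hY', hs'⟩⟩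

theorem gi_of_injective (X : Type u) [AddCommGroup X] [Module R X]
    (hX : Module.Injective R X) : GorensteinInjective R X := by
  refine gi_of_closed (fun X _ _ => Module.Injective R X) ?_ X hX
  intro X _ _ hX
  refine ⟨⟨PUnit, inferInstance, inferInstance, inj_subsingleton, X, inferInstance,
    inferInstance, LinearMap.id, 0, hX, ⟨fun _ _ h => h, ?_, ?_⟩, ?_⟩,
    ⟨PUnit, inferInstance, inferInstance, inj_subsingleton, X, inferInstance,
    inferInstance, 0, LinearMap.id, hX, ⟨?_, ?_, fun x => ⟨x, rfl⟩⟩, ?_⟩⟩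
  · intro y; simp
  · intro y; exact ⟨0, rfl⟩
  · intro E _ _ _ h; exact ⟨0, fun e => rfl⟩
  · intro x y _; rfl
  · intro y; simp [eq_comm]
  · intro E _ _ _ h; exact ⟨h, fun e => rfl⟩

section ses
variable {A B C : Type u} [AddCommGroup A] [Module R A] [AddCommGroup B] [Module R B]
    [AddCommGroup C] [Module R C] {f : A →ₗ[R] B} {g : B →ₗ[R] C}

theorem IsSES.zero (h : IsSES R f g) (a : A) : g (f a) = 0 := (h.2.1 _).2 ⟨a, rfl⟩

theorem IsSES.ex (h : IsSES R f g) {b : B} (hb : g b = 0) : ∃ a, f a = b := (h.2.1 _).1 hb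

/-- sequences starting with a Gorenstein injective are proper -/
theorem elift_of_gi (h : IsSES R f g) (hA : GorensteinInjective R A) : ELift g := by
  obtain ⟨A', _, _, hA', I, _, _, ι, p, hI, hs, hl⟩ := (gi_closed A hA).1
  obtain ⟨t, ht⟩ := hI.out f h.1 ι
  obtain ⟨s, hsg⟩ := aux_desc g h.2.2 (p.comp t) (fun b hb => by
    obtain ⟨a, rfl⟩ := h.ex hb
    simp [ht, hs.zero])
  intro E _ _ hE k
  obtain ⟨l, hl'⟩ := hl E _ _ hE (s.comp k)
  -- lift to `C × I`
  have hinj : Function.Injective (g.prod t) := by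
    rw [injective_iff_map_eq_zero]
    intro b hb
    have hb1 : g b = 0 := congrArg Prod.fst hb
    have hb2 : t b = 0 := congrArg Prod.snd hb
    obtain ⟨a, rfl⟩ := h.ex hb1
    rw [ht] at hb2
    rw [hs.1 (hb2.trans (map_zero ι).symm), map_zero]
  obtain ⟨m, hm⟩ := aux_lift (g.prod t) hinj (k.prod l) (fun e => by
    obtain ⟨b, hb⟩ := h.2.2 (k e)
    have : p (l e - t b) = 0 := by
      rw [map_sub, hl', sub_eq_zero]
      change s (k e) = p (t b)
      rw [← hb, hsg]; rfl
    obtain ⟨a, ha⟩ := hs.ex this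
    refine ⟨b + f a, Prod.ext ?_ ?_⟩
    · simp [h.zero, hb]
    · simp [ht, ha])
  exact ⟨m, fun e => congrArg Prod.fst (hm e)⟩

theorem ses_quot (h : Function.Injective f) : IsSES R f (LinearMap.range f).mkQ := by
  refine ⟨h, fun b => ?_, Submodule.mkQ_surjective _⟩
  rw [Submodule.mkQ_apply, Submodule.Quotient.mk_eq_zero]; rfl

theorem ses_ker (h : Function.Surjective g) : IsSES R (LinearMap.ker g).subtype g := by
  refine ⟨Subtype.val_injective, fun b => ?_, h⟩
  constructor
  · intro hb; exact ⟨⟨b, hb⟩, rfl⟩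
  · rintro ⟨x, rfl⟩; exact x.2

/-- Elements-lifting for the middle term -/
theorem elift_of_parts (h : IsSES R f g) {I : Type u} [AddCommGroup I] [Module R I]
    {I1 I2 : Type u} [AddCommGroup I1] [Module R I1] [AddCommGroup I2] [Module R I2]
    {q : I →ₗ[R] B} {j : I1 →ₗ[R] I} {s : I2 →ₗ[R] I} {p1 : I1 →ₗ[R] A} {p2 : I2 →ₗ[R] C}
    (hj : ∀ x, q (j x) = f (p1 x)) (hr : ∀ x, g (q (s x)) = p2 x)
    (h1 : ELift p1) (h2 : ELift p2) : ELift q := by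
  intro E _ _ hE k
  obtain ⟨l, hl⟩ := h2 E _ _ hE (g.comp k)
  obtain ⟨m, hm⟩ := aux_lift f h.1 (k - q.comp (s.comp l)) (fun e => h.ex (by
    simp [hr, hl]))
  obtain ⟨n, hn⟩ := h1 E _ _ hE m
  refine ⟨j.comp n + s.comp l, fun e => ?_⟩
  simp [hj, hn, hm]

/-- horseshoe on the right -/
theorem horseshoe_right (h : IsSES R f g)
    {I A' J C' : Type u} [AddCommGroup I] [Module R I] [AddCommGroup A'] [Module R A']
    [AddCommGroup J] [Module R J] [AddCommGroup C'] [Module R C']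
    {ι : A →ₗ[R] I} {p : I →ₗ[R] A'} {κ : C →ₗ[R] J} {q : J →ₗ[R] C'}
    (hI : Module.Injective R I) (h1 : IsSES R ι p) (h2 : IsSES R κ q) :
    ∃ (B' : Type u) (_ : AddCommGroup B') (_ : Module R B') (m : B →ₗ[R] I × J)
      (w : I × J →ₗ[R] B') (f' : A' →ₗ[R] B') (g' : B' →ₗ[R] C'),
      IsSES R m w ∧ IsSES R f' g' ∧ (∀ x, w (LinearMap.inl R I J x) = f' (p x)) ∧
      (∀ x, g' (w (LinearMap.inr R I J x)) = q x) := by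
  obtain ⟨t, ht⟩ := hI.out f h.1 ι
  have hinj : Function.Injective (t.prod (κ.comp g)) := by
    rw [injective_iff_map_eq_zero]
    intro b hb
    have hb2 : t b = 0 := congrArg Prod.fst hb
    have hb1 : κ (g b) = 0 := congrArg Prod.snd hb
    obtain ⟨a, rfl⟩ := h.ex (h2.1 (hb1.trans (map_zero κ).symm))
    rw [ht] at hb2
    rw [h1.1 (hb2.trans (map_zero ι).symm), map_zero]
  have hq := ses_quot hinj
  set w := (LinearMap.range (t.prod (κ.comp g))).mkQ with hw
  obtain ⟨f', hf'⟩ := aux_desc p h1.2.2 (w.comp (LinearMap.inl R I J)) (fun x hx => by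
    obtain ⟨a, rfl⟩ := h1.ex hx
    have := hq.zero (f a)
    rw [← this]
    simp [ht, h.zero])
  obtain ⟨g', hg'⟩ := aux_desc w hq.2.2 (q.comp (LinearMap.snd R I J)) (fun x hx => by
    obtain ⟨b, rfl⟩ := hq.ex hx
    simp [h2.zero])
  refine ⟨_, _, _, _, w, f', g', hq, ⟨?_, ?_, ?_⟩, fun x => (hf' x).symm, fun x => by simp [hg']⟩
  · rw [injective_iff_map_eq_zero]
    intro a ha
    obtain ⟨x, rfl⟩ := h1.2.2 a
    rw [hf'] at ha
    obtain ⟨b, hb⟩ := hq.ex ha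
    have hb2 : t b = x := congrArg Prod.fst hb
    have hb1 : κ (g b) = 0 := congrArg Prod.snd hb
    obtain ⟨a, rfl⟩ := h.ex (h2.1 (hb1.trans (map_zero κ).symm))
    rw [← hb2, ht, h1.zero]
  · intro b
    constructor
    · intro hb
      obtain ⟨⟨x, y⟩, rfl⟩ := hq.2.2 b
      rw [hg'] at hb
      obtain ⟨c, hc⟩ := h2.ex (b := y) hb
      obtain ⟨b, rfl⟩ := h.2.2 c
      refine ⟨p (x - t b), ?_⟩
      rw [hf']
      have := hq.zero b
      have h3 : w (x, y) = w (LinearMap.inl R I J (x - t b)) + w (t.prod (κ.comp g) b) := by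
        rw [← map_add]; congr 1; simp [hc]
      rw [h3, this, add_zero]; rfl
    · rintro ⟨a, rfl⟩
      obtain ⟨x, rfl⟩ := h1.2.2 a
      rw [hf']
      simp [hg']
  · intro c
    obtain ⟨y, rfl⟩ := h2.2.2 c
    exact ⟨w (0, y), by simp [hg']⟩

/-- horseshoe on the left -/
theorem horseshoe_left (h : IsSES R f g)
    {I A' J C' : Type u} [AddCommGroup I] [Module R I] [AddCommGroup A'] [Module R A']
    [AddCommGroup J] [Module R J] [AddCommGroup C'] [Module R C']
    {ι : A' →ₗ[R] I} {p : I →ₗ[R] A} {κ : C' →ₗ[R] J} {q : J →ₗ[R] C}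
    (s : J →ₗ[R] B) (hs : ∀ x, g (s x) = q x) (h1 : IsSES R ι p) (h2 : IsSES R κ q) :
    ∃ (B' : Type u) (_ : AddCommGroup B') (_ : Module R B') (m : B' →ₗ[R] I × J)
      (w : I × J →ₗ[R] B) (f' : A' →ₗ[R] B') (g' : B' →ₗ[R] C'),
      IsSES R m w ∧ IsSES R f' g' ∧ (∀ x, w (LinearMap.inl R I J x) = f (p x)) ∧
      (∀ x, g (w (LinearMap.inr R I J x)) = q x) := by
  set w : I × J →ₗ[R] B := (f.comp p).coprod s with hw
  have hwa : ∀ x y, w (x, y) = f (p x) + s y := fun x y => by simp [hw]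
  have hsurj : Function.Surjective w := by
    intro b
    obtain ⟨y, hy⟩ := h2.2.2 (g b)
    obtain ⟨a, ha⟩ := h.ex (b := b - s y) (by rw [map_sub, hs, hy, sub_self])
    obtain ⟨x, rfl⟩ := h1.2.2 a
    exact ⟨(x, y), by rw [hwa, ha]; abel⟩
  have hk := ses_ker hsurj
  obtain ⟨f', hf'⟩ := aux_lift (LinearMap.ker w).subtype hk.1 ((LinearMap.inl R I J).comp ι)
    (fun a => hk.ex (by simp [hwa, h1.zero]))
  obtain ⟨g', hg'⟩ := aux_lift κ h2.1 ((LinearMap.snd R I J).comp (LinearMap.ker w).subtype)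
    (fun z => h2.ex (by
      have hz : w (z.1.1, z.1.2) = 0 := z.2
      rw [hwa] at hz
      have := congrArg g hz
      rw [map_add, h.zero, zero_add, hs, map_zero] at this
      exact this))
  refine ⟨_, _, _, _, w, f', g', hk, ⟨?_, ?_, ?_⟩, fun x => by simp [hwa], fun x => by simp [hwa, hs]⟩
  · rw [injective_iff_map_eq_zero]
    intro a ha
    have := hf' a
    rw [ha, map_zero] at this
    exact h1.1 ((congrArg Prod.fst this).symm.trans (map_zero ι).symm)
  · intro z
    constructor
    · intro hz
      have h0 := hg' z
      rw [hz, map_zero] at h0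
      have hz2 : z.1.2 = 0 := h0.symm
      have hzw : w (z.1.1, z.1.2) = 0 := z.2
      rw [hwa, hz2, map_zero, add_zero] at hzw
      obtain ⟨a, ha⟩ := h1.ex (h.1 (hzw.trans (map_zero f).symm))
      refine ⟨a, Subtype.ext ?_⟩
      exact (hf' a).trans (Prod.ext ha hz2.symm)
    · rintro ⟨a, rfl⟩
      apply h2.1
      rw [hg', map_zero]
      exact congrArg Prod.snd (hf' a)
  · intro c
    obtain ⟨a, ha⟩ := h.ex (b := s (κ c)) (by rw [hs, h2.zero])
    obtain ⟨x, rfl⟩ := h1.2.2 a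
    refine ⟨⟨(-x, κ c), by simp [hwa, ha]⟩, h2.1 ?_⟩
    rw [hg']; rfl

end ses

/-- Gorenstein injectives are closed under extensions. -/
theorem gi_ext {A B C : Type u} [AddCommGroup A] [Module R A] [AddCommGroup B] [Module R B]
    [AddCommGroup C] [Module R C] {f : A →ₗ[R] B} {g : B →ₗ[R] C} (h : IsSES R f g)
    (hA : GorensteinInjective R A) (hC : GorensteinInjective R C) :
    GorensteinInjective R B := by
  refine gi_of_closed (fun B _ _ => ∃ (A : Type u) (_ : AddCommGroup A) (_ : Module R A)
    (C : Type u) (_ : AddCommGroup C) (_ : Module R C) (f : A →ₗ[R] B) (g : B →ₗ[R] C),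
    IsSES R f g ∧ GorensteinInjective R A ∧ GorensteinInjective R C) ?_ B
    ⟨A, _, _, C, _, _, f, g, h, hA, hC⟩
  rintro B _ _ ⟨A, _, _, C, _, _, f, g, h, hA, hC⟩
  obtain ⟨⟨A', _, _, hA', I, _, _, ι, p, hI, hs, hl⟩,
    ⟨A1, _, _, hA1, I1, _, _, ι1, p1, hI1, hs1, hl1⟩⟩ := gi_closed A hA
  obtain ⟨⟨C', _, _, hC', J, _, _, κ, q, hJ, ht, hm⟩,
    ⟨C1, _, _, hC1, J1, _, _, κ1, q1, hJ1, ht1, hm1⟩⟩ := gi_closed C hC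
  constructor
  · obtain ⟨B', _, _, m, w, f', g', ha, hb, hc, hd⟩ := horseshoe_right h hI hs ht
    exact ⟨B', _, _, ⟨A', _, _, C', _, _, f', g', hb, hA', hC'⟩, I × J, _, _, m, w,
      inj_prod hI hJ, ha, elift_of_parts hb hc hd hl hm⟩
  · obtain ⟨s, hs'⟩ := elift_of_gi h hA J1 _ _ hJ1 q1
    obtain ⟨B', _, _, m, w, f', g', ha, hb, hc, hd⟩ := horseshoe_left h s hs' hs1 ht1
    exact ⟨B', _, _, ⟨A1, _, _, C1, _, _, f', g', hb, hA1, hC1⟩, I1 × J1, _, _, m, w,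
      inj_prod hI1 hJ1, ha, elift_of_parts h hc hd hl1 hm1⟩

/-- Third isomorphism type sequence: for `X → Y → Z` injective, quotients. -/
theorem ses_comp {X Y Z Q S : Type u} [AddCommGroup X] [Module R X] [AddCommGroup Y] [Module R Y]
    [AddCommGroup Z] [Module R Z] [AddCommGroup Q] [Module R Q] [AddCommGroup S] [Module R S]
    {a : X →ₗ[R] Y} {b : Y →ₗ[R] Z} {c : Y →ₗ[R] Q} {d : Z →ₗ[R] S}
    (h1 : IsSES R a c) (h2 : IsSES R b d) :
    ∃ (T : Type u) (_ : AddCommGroup T) (_ : Module R T) (w : Z →ₗ[R] T) (i : Q →ₗ[R] T)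
      (j : T →ₗ[R] S), IsSES R (b.comp a) w ∧ IsSES R i j ∧ (∀ y, w (b y) = i (c y)) ∧
      (∀ z, j (w z) = d z) := by
  have hq := ses_quot (f := b.comp a) (h2.1.comp h1.1)
  set w := (LinearMap.range (b.comp a)).mkQ with hw
  obtain ⟨i, hi⟩ := aux_desc c h1.2.2 (w.comp b) (fun y hy => by
    obtain ⟨x, rfl⟩ := h1.ex hy
    exact hq.zero x)
  obtain ⟨j, hj⟩ := aux_desc w hq.2.2 d (fun z hz => by
    obtain ⟨x, rfl⟩ := hq.ex hz
    exact h2.zero _)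
  refine ⟨_, _, _, w, i, j, hq, ⟨?_, ?_, ?_⟩, fun y => (hi y).symm, hj⟩
  · rw [injective_iff_map_eq_zero]
    intro y hy
    obtain ⟨y, rfl⟩ := h1.2.2 y
    rw [hi] at hy
    obtain ⟨x, hx⟩ := hq.ex hy
    rw [← h2.1 hx, h1.zero]
  · intro t
    obtain ⟨z, rfl⟩ := hq.2.2 t
    constructor
    · intro hz
      rw [hj] at hz
      obtain ⟨y, rfl⟩ := h2.ex hz
      exact ⟨c y, hi y⟩
    · rintro ⟨y, hy⟩
      obtain ⟨y, rfl⟩ := h1.2.2 y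
      rw [← hy, hi]
      simp [hj, h2.zero]
  · intro s
    obtain ⟨z, rfl⟩ := h2.2.2 s
    exact ⟨w z, hj z⟩

/-- Dual: kernels of composites of surjections. -/
theorem ses_comp_ker {X Y Z Q S : Type u} [AddCommGroup X] [Module R X] [AddCommGroup Y]
    [Module R Y] [AddCommGroup Z] [Module R Z] [AddCommGroup Q] [Module R Q] [AddCommGroup S]
    [Module R S] {a : X →ₗ[R] Y} {b : Y →ₗ[R] Z} {c : Q →ₗ[R] X} {d : S →ₗ[R] Y}
    (h1 : IsSES R c a) (h2 : IsSES R d b) :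
    ∃ (T : Type u) (_ : AddCommGroup T) (_ : Module R T) (w : T →ₗ[R] X) (i : Q →ₗ[R] T)
      (j : T →ₗ[R] S), IsSES R w (b.comp a) ∧ IsSES R i j := by
  have hk := ses_ker (g := b.comp a) (h2.2.2.comp h1.2.2)
  set w := (LinearMap.ker (b.comp a)).subtype with hw
  obtain ⟨i, hi⟩ := aux_lift w hk.1 c (fun q => hk.ex (by simp [h1.zero]))
  obtain ⟨j, hj⟩ := aux_lift d h2.1 (a.comp w) (fun t => h2.ex (hk.zero t))
  refine ⟨_, _, _, w, i, j, hk, ⟨?_, ?_, ?_⟩⟩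
  · intro x y hxy
    apply h1.1
    rw [← hi, ← hi, hxy]
  · intro t
    constructor
    · intro ht
      have := hj t
      rw [ht, map_zero] at this
      obtain ⟨q, hq⟩ := h1.ex this.symm
      exact ⟨q, hk.1 ((hi q).trans hq)⟩
    · rintro ⟨q, rfl⟩
      apply h2.1
      rw [hj, map_zero]
      simp [hi, h1.zero]
  · intro s
    obtain ⟨x, hx⟩ := h1.2.2 (d s)
    obtain ⟨t, rfl⟩ := hk.ex (b := x) (by simp [hx, h2.zero])
    exact ⟨t, h2.1 ((hj t).trans hx)⟩

/-- Pushout. -/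
theorem ses_pushout {A B C I D : Type u} [AddCommGroup A] [Module R A] [AddCommGroup B]
    [Module R B] [AddCommGroup C] [Module R C] [AddCommGroup I] [Module R I] [AddCommGroup D]
    [Module R D] {f : A →ₗ[R] B} {g : B →ₗ[R] C} {ι : A →ₗ[R] I} {p : I →ₗ[R] D}
    (h1 : IsSES R f g) (h2 : IsSES R ι p) :
    ∃ (Q : Type u) (_ : AddCommGroup Q) (_ : Module R Q) (b : B →ₗ[R] Q) (b' : Q →ₗ[R] D)
      (i : I →ₗ[R] Q) (i' : Q →ₗ[R] C), IsSES R b b' ∧ IsSES R i i' := by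
  have hinj : Function.Injective (f.prod ι) := fun x y hxy => h1.1 (congrArg Prod.fst hxy)
  have hq := ses_quot hinj
  set w := (LinearMap.range (f.prod ι)).mkQ with hw
  obtain ⟨b', hb'⟩ := aux_desc w hq.2.2 (p.comp (LinearMap.snd R B I)) (fun z hz => by
    obtain ⟨x, rfl⟩ := hq.ex hz
    simp [h2.zero])
  obtain ⟨i', hi'⟩ := aux_desc w hq.2.2 (g.comp (LinearMap.fst R B I)) (fun z hz => by
    obtain ⟨x, rfl⟩ := hq.ex hz
    simp [h1.zero])
  refine ⟨_, _, _, w.comp (LinearMap.inl R B I), b', w.comp (LinearMap.inr R B I), i',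
    ⟨?_, ?_, ?_⟩, ⟨?_, ?_, ?_⟩⟩
  · rw [injective_iff_map_eq_zero]
    intro b hb
    obtain ⟨a, ha⟩ := hq.ex hb
    have ha1 : f a = b := congrArg Prod.fst ha
    have ha2 : ι a = 0 := congrArg Prod.snd ha
    rw [← ha1, h2.1 (ha2.trans (map_zero ι).symm), map_zero]
  · intro z
    obtain ⟨⟨x, y⟩, rfl⟩ := hq.2.2 z
    constructor
    · intro hz
      rw [hb'] at hz
      obtain ⟨a, ha⟩ := h2.ex (b := y) hz
      refine ⟨x - f a, ?_⟩
      have h3 : ((x, y) : B × I) = LinearMap.inl R B I (x - f a) + f.prod ι a := by simp [ha]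
      rw [h3, map_add, hq.zero, add_zero]; rfl
    · rintro ⟨x', hx⟩
      rw [← hx]
      simp [hb']
  · intro c
    obtain ⟨y, rfl⟩ := h2.2.2 c
    exact ⟨w (0, y), by simp [hb']⟩
  · rw [injective_iff_map_eq_zero]
    intro b hb
    obtain ⟨a, ha⟩ := hq.ex hb
    have ha1 : f a = 0 := congrArg Prod.fst ha
    have ha2 : ι a = b := congrArg Prod.snd ha
    rw [← ha2, h1.1 (ha1.trans (map_zero f).symm), map_zero]
  · intro z
    obtain ⟨⟨x, y⟩, rfl⟩ := hq.2.2 z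
    constructor
    · intro hz
      rw [hi'] at hz
      obtain ⟨a, ha⟩ := h1.ex (b := x) hz
      refine ⟨y - ι a, ?_⟩
      have h3 : ((x, y) : B × I) = LinearMap.inr R B I (y - ι a) + f.prod ι a := by simp [ha]
      rw [h3, map_add, hq.zero, add_zero]; rfl
    · rintro ⟨x', hx⟩
      rw [← hx]
      simp [hi']
  · intro c
    obtain ⟨y, rfl⟩ := h1.2.2 c
    exact ⟨w (y, 0), by simp [hi']⟩

/-- Gorenstein injectives are closed under cokernels of monomorphisms. -/
theorem gi_coker {A B C : Type u} [AddCommGroup A] [Module R A] [AddCommGroup B] [Module R B]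
    [AddCommGroup C] [Module R C] {f : A →ₗ[R] B} {g : B →ₗ[R] C} (h : IsSES R f g)
    (hA : GorensteinInjective R A) (hB : GorensteinInjective R B) :
    GorensteinInjective R C := by
  apply gi_of_steps
  · obtain ⟨A', _, _, hA', I, _, _, ι, p, hI, hs, hl⟩ := (gi_closed A hA).1
    obtain ⟨Q, _, _, b, b', i, i', hQ1, hQ2⟩ := ses_pushout h hs
    have hQ : GorensteinInjective R Q := gi_ext hQ1 hB hA'
    obtain ⟨r, hr⟩ := hI.out i hQ2.1 LinearMap.id
    have hr' : ∀ x, r (i x) = x := hr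
    obtain ⟨s, hs'⟩ := aux_desc i' hQ2.2.2 (LinearMap.id - i.comp r) (fun z hz => by
      obtain ⟨x, rfl⟩ := hQ2.ex hz
      simp [hr'])
    have hs'' : ∀ z, s (i' z) = z - i (r z) := hs'
    have hsr : IsSES R s r := by
      refine ⟨?_, ?_, fun x => ⟨i x, hr' x⟩⟩
      · rw [injective_iff_map_eq_zero]
        intro c hc
        obtain ⟨z, rfl⟩ := hQ2.2.2 c
        rw [hs'', sub_eq_zero] at hc
        rw [hc, hQ2.zero]
      · intro z
        constructor
        · intro hz
          exact ⟨i' z, by rw [hs'', hz, map_zero, sub_zero]⟩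
        · rintro ⟨c, rfl⟩
          obtain ⟨z, rfl⟩ := hQ2.2.2 c
          rw [hs'', map_sub, hr', sub_self]
    obtain ⟨X, _, _, hX, J, _, _, κ, q, hJ, ht, hm⟩ := (gi_closed Q hQ).1
    obtain ⟨T, _, _, w, u, v, hw, huv, e1, e2⟩ := ses_comp hsr ht
    refine ⟨T, _, _, gi_ext huv (gi_of_injective I hI) hX, J, _, _, _, w, hJ, hw, ?_⟩
    refine elift_of_parts huv (j := κ.comp i) (s := LinearMap.id) (p1 := LinearMap.id)
      (p2 := q) (fun x => ?_) (fun x => e2 x) (fun E _ _ _ k => ⟨k, fun _ => rfl⟩) hm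
    simp [e1, hr']
  · obtain ⟨B1, _, _, hB1, J, _, _, κ, q, hJ, ht, hm⟩ := (gi_closed B hB).2
    obtain ⟨T, _, _, w, i, j, hw, hij⟩ := ses_comp_ker ht h
    refine ⟨T, _, _, gi_ext hij hB1 hA, J, _, _, w, _, hJ, hw, ?_⟩
    intro E _ _ hE k
    obtain ⟨l, hl⟩ := elift_of_gi h hA E _ _ hE k
    obtain ⟨n, hn⟩ := hm E _ _ hE l
    exact ⟨n, fun e => by simp [hn, hl]⟩

variable (R) in
/-- Recursive form of `Gid ≤ n`. -/
def GidLE : ℕ → ∀ (M : Type u) [AddCommGroup M] [Module R M], Prop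
  | 0, M, _, _ => GorensteinInjective R M
  | n + 1, M, _, _ => ∃ (G : Type u) (_ : AddCommGroup G) (_ : Module R G) (C : Type u)
      (_ : AddCommGroup C) (_ : Module R C) (ι : M →ₗ[R] G) (p : G →ₗ[R] C),
      GorensteinInjective R G ∧ IsSES R ι p ∧ GidLE n C

theorem GidLE.succ : ∀ (n : ℕ) (M : Type u) [AddCommGroup M] [Module R M],
    GidLE R n M → GidLE R (n + 1) M
  | 0, M, _, _, h => by
    obtain ⟨A', _, _, hA', I, _, _, ι, p, hI, hs, hl⟩ := (gi_closed M h).1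
    exact ⟨I, _, _, A', _, _, ι, p, gi_of_injective I hI, hs, hA'⟩
  | n + 1, M, _, _, h => by
    obtain ⟨G, _, _, C, _, _, ι, p, hG, hs, hC⟩ := h
    exact ⟨G, _, _, C, _, _, ι, p, hG, hs, GidLE.succ n C hC⟩

theorem GidLE.of_gi (n : ℕ) (M : Type u) [AddCommGroup M] [Module R M]
    (h : GorensteinInjective R M) : GidLE R n M := by
  induction n with
  | zero => exact h
  | succ n ih => exact GidLE.succ n M ih

theorem GidLE.ext (n : ℕ) : ∀ {A B C : Type u} [AddCommGroup A] [Module R A] [AddCommGroup B]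
    [Module R B] [AddCommGroup C] [Module R C] {f : A →ₗ[R] B} {g : B →ₗ[R] C} (_ : IsSES R f g)
    (_ : GidLE R n A) (_ : GidLE R n C), GidLE R n B := by
  induction n with
  | zero => intro A B C _ _ _ _ _ _ f g h hA hC; exact gi_ext h hA hC
  | succ n ih =>
    have key : ∀ (M : Type u) [AddCommGroup M] [Module R M], GidLE R (n + 1) M →
        ∃ (I : Type u) (_ : AddCommGroup I) (_ : Module R I) (C : Type u)
        (_ : AddCommGroup C) (_ : Module R C) (ι : M →ₗ[R] I) (p : I →ₗ[R] C),
        Module.Injective R I ∧ IsSES R ι p ∧ GidLE R n C := by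
      intro M _ _ h
      obtain ⟨G, _, _, C, _, _, ι, p, hG, hs, hC⟩ := h
      obtain ⟨A', _, _, hA', I, _, _, κ, q, hI, ht, -⟩ := (gi_closed G hG).1
      obtain ⟨T, _, _, w, u, v, hw, huv, -, -⟩ := ses_comp hs ht
      exact ⟨I, _, _, T, _, _, _, w, hI, hw, ih huv hC (GidLE.of_gi n A' hA')⟩
    intro A B C _ _ _ _ _ _ f g h hA hC
    obtain ⟨I, _, _, A', _, _, ι, p, hI, hs, hA'⟩ := key A hA
    obtain ⟨J, _, _, C', _, _, κ, q, hJ, ht, hC'⟩ := key C hC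
    obtain ⟨B', _, _, m, w, f', g', ha, hb, -, -⟩ := horseshoe_right h hI hs ht
    exact ⟨I × J, _, _, B', _, _, m, w, gi_of_injective _ (inj_prod hI hJ), ha, ih hb hA' hC'⟩

theorem GidLE.coker (n : ℕ) {A B C : Type u} [AddCommGroup A] [Module R A] [AddCommGroup B]
    [Module R B] [AddCommGroup C] [Module R C] {f : A →ₗ[R] B} {g : B →ₗ[R] C} (h : IsSES R f g)
    (hA : GidLE R n A) (hB : GidLE R n B) : GidLE R n C := by
  cases n with
  | zero => exact gi_coker h hA hB
  | succ n =>
    obtain ⟨G, _, _, D, _, _, ι, p, hG, hs, hD⟩ := hA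
    obtain ⟨Q, _, _, b, b', i, i', hQ1, hQ2⟩ := ses_pushout h hs
    have hQ : GidLE R (n + 1) Q := GidLE.ext (n + 1) hQ1 hB (GidLE.succ n D hD)
    obtain ⟨H, _, _, D', _, _, κ, q, hH, ht, hD'⟩ := hQ
    obtain ⟨T, _, _, w, u, v, hw, huv, -, -⟩ := ses_comp hQ2 ht
    exact ⟨T, _, _, D', _, _, u, v, gi_coker hw hG hH, huv, hD'⟩

theorem GidLE.of_res (n : ℕ) : ∀ (M : Type u) [AddCommGroup M] [Module R M],
    HasRightResolutionLE R (fun N _ _ => GorensteinInjective R N) M n → GidLE R n M := by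
  induction n with
  | zero =>
    rintro M _ _ ⟨G, _, _, d, ι, hG, h0, hi, he, hd⟩
    have := h0 (0 + 1) (by omega)
    have hs : Function.Surjective ι := fun y => (he y).1 (Subsingleton.elim _ _)
    exact (hG 0).iso (LinearEquiv.ofBijective ι ⟨hi, hs⟩).symm
  | succ n ih =>
    rintro M _ _ ⟨G, _, _, d, ι, hG, h0, hi, he, hd⟩
    refine ⟨G 0, _, _, LinearMap.range (d 0), inferInstance, inferInstance, ι,
      (d 0).rangeRestrict, hG 0, ⟨hi, ?_, (d 0).surjective_rangeRestrict⟩, ?_⟩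
    · intro y
      rw [← he y]
      exact ⟨fun h => congrArg Subtype.val h, fun h => Subtype.ext h⟩
    · apply ih
      refine ⟨fun i => G (i + 1), inferInstance, inferInstance, fun i => d (i + 1),
        (LinearMap.range (d 0)).subtype, fun i => hG _, fun i hi => h0 _ (by omega),
        Subtype.val_injective, ?_, fun i => hd _⟩
      intro y
      rw [hd 0 y]
      simp

theorem res_of_gidLE (n : ℕ) : ∀ (M : Type u) [AddCommGroup M] [Module R M], GidLE R n M →
    HasRightResolutionLE R (fun N _ _ => GorensteinInjective R N) M n := by
  -- splice one step to a resolution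
  have key : ∀ (M G C : Type u) [AddCommGroup M] [Module R M] [AddCommGroup G] [Module R G]
      [AddCommGroup C] [Module R C] (ι : M →ₗ[R] G) (p : G →ₗ[R] C)
      (_ : GorensteinInjective R G) (_ : IsSES R ι p) (H : ℕ → ModuleCat.{u} R)
      (d : ∀ i, H i →ₗ[R] H (i + 1)) (j : C →ₗ[R] H 0) (_ : ∀ i, GorensteinInjective R (H i))
      (m : ℕ) (_ : ∀ i, m ≤ i → Subsingleton (H i)) (_ : Function.Injective j)
      (_ : Function.Exact j (d 0)) (_ : ∀ i, Function.Exact (d i) (d (i + 1))),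
      HasRightResolutionLE R (fun N _ _ => GorensteinInjective R N) M m := by
    intro M G C _ _ _ _ _ _ ι p hG hs H d j hH m hm hj he hd
    let G' : ℕ → ModuleCat.{u} R := fun i => match i with
      | 0 => ModuleCat.of R G
      | i + 1 => H i
    let d' : ∀ i, G' i →ₗ[R] G' (i + 1) := fun i => match i with
      | 0 => j.comp p
      | i + 1 => d i
    refine ⟨fun i => G' i, inferInstance, inferInstance, d', ι, ?_, ?_, hs.1, ?_, ?_⟩
    · rintro (_ | i)
      · exact hG
      · exact hH i
    · rintro (_ | i) hi
      · omega
      · exact hm i (by omega)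
    · intro y
      rw [← hs.2.1 y]
      exact ⟨fun h => hj (h.trans (map_zero j).symm), fun h => (congrArg j h).trans (map_zero j)⟩
    · rintro (_ | i)
      · intro y
        refine (he y).trans ⟨?_, ?_⟩
        · rintro ⟨c, rfl⟩
          obtain ⟨x, rfl⟩ := hs.2.2 c
          exact ⟨x, rfl⟩
        · rintro ⟨x, rfl⟩
          exact ⟨p x, rfl⟩
      · exact hd i
  induction n with
  | zero =>
    intro M _ _ h
    refine key M M PUnit LinearMap.id 0 h ⟨fun _ _ h => h, fun y => by simp, fun y => ⟨0, rfl⟩⟩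
      (fun _ => ModuleCat.of R PUnit) (fun _ => 0) 0
      (fun _ => gi_of_injective _ ?_) 0 (fun _ _ => ?_) (fun _ _ _ => rfl) (fun y => ?_)
      (fun _ y => ?_)
    · change Module.Injective R PUnit
      exact inj_subsingleton
    · change Subsingleton PUnit
      infer_instance
    · exact ⟨fun _ => ⟨PUnit.unit, rfl⟩, fun _ => rfl⟩
    · exact ⟨fun _ => ⟨PUnit.unit, rfl⟩, fun _ => rfl⟩
  | succ n ih =>
    intro M _ _ h
    obtain ⟨G, _, _, C, _, _, ι, p, hG, hs, hC⟩ := h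
    obtain ⟨H, _, _, d, j, hH, h0, hj, he, hd⟩ := ih C hC
    exact key M G C ι p hG hs (fun i => ModuleCat.of R (H i)) d j hH (n + 1)
      (fun i hi => h0 i hi) hj he hd

theorem giDim_le_iff (M : Type u) [AddCommGroup M] [Module R M] (n : ℕ) :
    giDim R M ≤ n ↔ GidLE R n M := by
  constructor
  · intro h
    apply GidLE.of_res
    have hne : (((↑) : ℕ → ℕ∞) '' {n : ℕ | HasRightResolutionLE R
        (fun N _ _ => GorensteinInjective R N) M n}).Nonempty := by
      by_contra hc
      rw [Set.not_nonempty_iff_eq_empty] at hc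
      unfold giDim at h
      rw [hc, sInf_empty] at h
      exact absurd h (by simp)
    obtain ⟨m, hm, hm'⟩ := csInf_mem hne
    have hmn : m ≤ n := by
      have : (m : ℕ∞) ≤ n := hm'.trans_le h
      exact_mod_cast this
    obtain ⟨G, i1, i2, d, ι, hG, h0, hr⟩ := hm
    exact ⟨G, i1, i2, d, ι, hG, fun i hi => h0 i (by omega), hr⟩
  · intro h
    exact sInf_le ⟨n, res_of_gidLE n M h, rfl⟩

end GIAux

/-- If `0 → K → N → M → 0` is a short exact sequence with `N` Gorenstein projective,
`Gid_R(K) ≤ n`, and `Gid_R(N) ≤ n`, then `Gid_R(M) ≤ n`. -/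
theorem giDim_le_of_ses (R : Type u) [Ring R]
    (K N M : Type u) [AddCommGroup K] [Module R K] [AddCommGroup N] [Module R N]
    [AddCommGroup M] [Module R M] (n : ℕ)
    (f : K →ₗ[R] N) (g : N →ₗ[R] M) (hses : IsSES R f g)
    (hN : GorensteinProjective R N)
    (hK : giDim R K ≤ n) (hN' : giDim R N ≤ n) :
    giDim R M ≤ n := by
  rw [giDim_le_iff] at hK hN' ⊢
  exact GidLE.coker n hses hK hN'
end
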